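/- Soundness of the denotational semantics: if M and N are typed terms of the recursively typed λ-calculus with parallel case and M →* N, then ⟦M⟧ε = ⟦N⟧ε for every environment ε. In particular the Substitution Lemma holds: ⟦M[x := N]⟧ε = ⟦M⟧(ε[x ↦ ⟦N⟧ε]) for all appropriately typed terms M, N and all ε. -/

import Mathlib

set_option autoImplicit false

namespace RecLam

/-- Type expressions: type variables, separated sum, product, function space,
recursion `μt.τ`, and `void`. -/
inductive TyExpr : Type where
  | tvar : ℕ → TyExpr
  | sum : TyExpr → TyExpr → TyExpr
  | prod : TyExpr → TyExpr → TyExpr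
  | arrow : TyExpr → TyExpr → TyExpr
  | mu : ℕ → TyExpr → TyExpr
  | void : TyExpr
  deriving DecidableEq

namespace TyExpr

/-- Free type variables of a type expression. -/
def freeTV : TyExpr → Finset ℕ
  | .tvar t => {t}
  | .sum a b => freeTV a ∪ freeTV b
  | .prod a b => freeTV a ∪ freeTV b
  | .arrow a b => freeTV a ∪ freeTV b
  | .mu t a => (freeTV a).erase t
  | .void => ∅

/-- A type expression is closed (a *type*) iff it has no free type variables. -/
def Closed (τ : TyExpr) : Prop := freeTV τ = ∅

/-- `substTy σ t ρ` is `σ[ρ/t]`, substitution of `ρ` for the free occurrences of `t`. -/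
def substTy : TyExpr → ℕ → TyExpr → TyExpr
  | .tvar s, t, ρ => if s = t then ρ else .tvar s
  | .sum a b, t, ρ => .sum (substTy a t ρ) (substTy b t ρ)
  | .prod a b, t, ρ => .prod (substTy a t ρ) (substTy b t ρ)
  | .arrow a b, t, ρ => .arrow (substTy a t ρ) (substTy b t ρ)
  | .mu s a, t, ρ => if s = t then .mu s a else .mu s (substTy a t ρ)
  | .void, _, _ => .void

end TyExpr

/-- One-step unfolding `↝` of an outermost `μ`-redex. -/
inductive Unfold : TyExpr → TyExpr → Prop
  | mu (t : ℕ) (a : TyExpr) : Unfold (.mu t a) (TyExpr.substTy a t (.mu t a))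
  | sumL {a a' : TyExpr} (b : TyExpr) : Unfold a a' → Unfold (.sum a b) (.sum a' b)
  | sumR (a : TyExpr) {b b' : TyExpr} : Unfold b b' → Unfold (.sum a b) (.sum a b')
  | prodL {a a' : TyExpr} (b : TyExpr) : Unfold a a' → Unfold (.prod a b) (.prod a' b)
  | prodR (a : TyExpr) {b b' : TyExpr} : Unfold b b' → Unfold (.prod a b) (.prod a b')
  | arrowL {a a' : TyExpr} (b : TyExpr) : Unfold a a' → Unfold (.arrow a b) (.arrow a' b)
  | arrowR (a : TyExpr) {b b' : TyExpr} : Unfold b b' → Unfold (.arrow a b) (.arrow a b')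

/-- `↝*`, the reflexive transitive closure of one-step unfolding. -/
def Unfolds : TyExpr → TyExpr → Prop := Relation.ReflTransGen Unfold

/-- The `void`-prefix order `σ ≼ τ`: the least relation with `void ≼ τ` for all `τ`
and compatible with the constructors `+`, `×`, `→`.  Its left-hand sides are
exactly the simple types. -/
inductive Pre : TyExpr → TyExpr → Prop
  | void (τ : TyExpr) : Pre .void τ
  | sum {s s' t t' : TyExpr} : Pre s s' → Pre t t' → Pre (.sum s t) (.sum s' t')
  | prod {s s' t t' : TyExpr} : Pre s s' → Pre t t' → Pre (.prod s t) (.prod s' t')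
  | arrow {s s' t t' : TyExpr} : Pre s s' → Pre t t' → Pre (.arrow s t) (.arrow s' t')

/-- The unfolding `τ* = { σ ∈ T ∣ ∃ τ'. τ ↝* τ' ∧ σ ≼ τ' }` of a type `τ`. -/
def unfolding (τ : TyExpr) : Set TyExpr := {σ | ∃ τ', Unfolds τ τ' ∧ Pre σ τ'}

/-- Two types are equivalent iff they have the same unfolding as (regular) trees. -/
def TyEquiv (σ τ : TyExpr) : Prop := unfolding σ = unfolding τ

end RecLam

namespace RecLam

/-- The constants of the calculus, with their type subscripts. -/
inductive Const : Type where
  | czero : TyExpr → TyExpr → Const      -- 0_{σ,τ} : σ → (σ+τ)   ("inleft")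
  | cone : TyExpr → TyExpr → Const       -- 1_{σ,τ} : τ → (σ+τ)   ("inright")
  | ccase : TyExpr → TyExpr → TyExpr → Const   -- case_{σ,τ,ρ}
  | cpcase : TyExpr → TyExpr → TyExpr → Const  -- pcase_{σ,τ,ρ}
  | cpair : TyExpr → TyExpr → Const      -- pair_{σ,τ}
  | cfst : TyExpr → TyExpr → Const       -- fst_{σ,τ}
  | csnd : TyExpr → TyExpr → Const       -- snd_{σ,τ}
  | comega : TyExpr → Const              -- Ω_σ
  deriving DecidableEq

/-- The type of each constant. -/
def constType : Const → TyExpr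
  | .czero σ τ => .arrow σ (.sum σ τ)
  | .cone σ τ => .arrow τ (.sum σ τ)
  | .ccase σ τ ρ => .arrow (.sum σ τ) (.arrow (.arrow σ ρ) (.arrow (.arrow τ ρ) ρ))
  | .cpcase σ τ ρ => .arrow (.sum σ τ) (.arrow ρ (.arrow ρ ρ))
  | .cpair σ τ => .arrow σ (.arrow τ (.prod σ τ))
  | .cfst σ τ => .arrow (.prod σ τ) σ
  | .csnd σ τ => .arrow (.prod σ τ) τ
  | .comega σ => σ

/-- Terms, in de Bruijn representation (so terms are identified up to α-conversion):
variables, constants, application and λ-abstraction (the binder carries the type of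
the abstracted variable). -/
inductive Tm : Type where
  | var : ℕ → Tm
  | const : Const → Tm
  | app : Tm → Tm → Tm
  | lam : TyExpr → Tm → Tm
  deriving DecidableEq

/-- Lift (shift) the de Bruijn variables `≥ d` by one. -/
def liftTm (d : ℕ) : Tm → Tm
  | .var n => if n < d then .var n else .var (n + 1)
  | .const c => .const c
  | .app M N => .app (liftTm d M) (liftTm d N)
  | .lam σ M => .lam σ (liftTm (d + 1) M)

/-- Capture-avoiding substitution `M[k := N]` (de Bruijn). -/
def substTm : Tm → ℕ → Tm → Tm
  | .var n, k, N => if n = k then N else if k < n then .var (n - 1) else .var n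
  | .const c, _, _ => .const c
  | .app M P, k, N => .app (substTm M k N) (substTm P k N)
  | .lam σ M, k, N => .lam σ (substTm M (k + 1) (liftTm 0 N))

/-- The typing relation.  A context is a list of types of the free de Bruijn
variables.  It includes the rule (≈): a term of a type `σ` also has every type
equivalent to `σ`. -/
inductive HasType : List TyExpr → Tm → TyExpr → Prop
  | var {Γ : List TyExpr} {n : ℕ} {σ : TyExpr} :
      Γ[n]? = some σ → HasType Γ (.var n) σ
  | const {Γ : List TyExpr} (c : Const) : HasType Γ (.const c) (constType c)
  | app {Γ : List TyExpr} {M N : Tm} {σ τ : TyExpr} :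
      HasType Γ M (.arrow σ τ) → HasType Γ N σ → HasType Γ (.app M N) τ
  | lam {Γ : List TyExpr} {M : Tm} {σ τ : TyExpr} :
      HasType (σ :: Γ) M τ → HasType Γ (.lam σ M) (.arrow σ τ)
  | equiv {Γ : List TyExpr} {M : Tm} {σ τ : TyExpr} :
      HasType Γ M σ → TyEquiv σ τ → HasType Γ M τ

/-- One-step reduction: β-reduction, the ten rewrite rules for the constants,
closed under arbitrary contexts. -/
inductive Step : Tm → Tm → Prop
  | beta (σ : TyExpr) (M N : Tm) :
      Step (.app (.lam σ M) N) (substTm M 0 N)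
  | caseZero (σ τ ρ σ' τ' : TyExpr) (x y z : Tm) :
      Step (.app (.app (.app (.const (.ccase σ τ ρ)) (.app (.const (.czero σ' τ')) x)) y) z)
        (.app y x)
  | caseOne (σ τ ρ σ' τ' : TyExpr) (x y z : Tm) :
      Step (.app (.app (.app (.const (.ccase σ τ ρ)) (.app (.const (.cone σ' τ')) x)) y) z)
        (.app z x)
  | fstPair (σ τ σ' τ' : TyExpr) (x y : Tm) :
      Step (.app (.const (.cfst σ τ)) (.app (.app (.const (.cpair σ' τ')) x) y)) x
  | sndPair (σ τ σ' τ' : TyExpr) (x y : Tm) :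
      Step (.app (.const (.csnd σ τ)) (.app (.app (.const (.cpair σ' τ')) x) y)) y
  | pcaseZero (σ τ ρ σ' τ' : TyExpr) (x y z : Tm) :
      Step (.app (.app (.app (.const (.cpcase σ τ ρ)) (.app (.const (.czero σ' τ')) x)) y) z) y
  | pcaseOne (σ τ ρ σ' τ' : TyExpr) (x y z : Tm) :
      Step (.app (.app (.app (.const (.cpcase σ τ ρ)) (.app (.const (.cone σ' τ')) x)) y) z) z
  | pcaseZZ (σ τ ρ₀ ρ₁ σ₁ τ₁ σ₂ τ₂ : TyExpr) (x y z : Tm) :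
      Step (.app (.app (.app (.const (.cpcase σ τ (.sum ρ₀ ρ₁))) x)
              (.app (.const (.czero σ₁ τ₁)) y)) (.app (.const (.czero σ₂ τ₂)) z))
        (.app (.const (.czero ρ₀ ρ₁)) (.app (.app (.app (.const (.cpcase σ τ ρ₀)) x) y) z))
  | pcaseOO (σ τ ρ₀ ρ₁ σ₁ τ₁ σ₂ τ₂ : TyExpr) (x y z : Tm) :
      Step (.app (.app (.app (.const (.cpcase σ τ (.sum ρ₀ ρ₁))) x)
              (.app (.const (.cone σ₁ τ₁)) y)) (.app (.const (.cone σ₂ τ₂)) z))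
        (.app (.const (.cone ρ₀ ρ₁)) (.app (.app (.app (.const (.cpcase σ τ ρ₁)) x) y) z))
  | pcasePair (σ τ ρ₁ ρ₂ σ₁ τ₁ σ₂ τ₂ : TyExpr) (x y₁ y₂ z₁ z₂ : Tm) :
      Step (.app (.app (.app (.const (.cpcase σ τ (.prod ρ₁ ρ₂))) x)
              (.app (.app (.const (.cpair σ₁ τ₁)) y₁) y₂))
              (.app (.app (.const (.cpair σ₂ τ₂)) z₁) z₂))
        (.app (.app (.const (.cpair ρ₁ ρ₂))
            (.app (.app (.app (.const (.cpcase σ τ ρ₁)) x) y₁) z₁))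
          (.app (.app (.app (.const (.cpcase σ τ ρ₂)) x) y₂) z₂))
  | pcaseArrow (σ τ ρ₁ ρ₂ : TyExpr) (x y z w : Tm) :
      Step (.app (.app (.app (.app (.const (.cpcase σ τ (.arrow ρ₁ ρ₂))) x) y) z) w)
        (.app (.app (.app (.const (.cpcase σ τ ρ₂)) x) (.app y w)) (.app z w))
  | appL {M M' : Tm} (N : Tm) : Step M M' → Step (.app M N) (.app M' N)
  | appR (M : Tm) {N N' : Tm} : Step N N' → Step (.app M N) (.app M N')
  | lamC (σ : TyExpr) {M M' : Tm} : Step M M' → Step (.lam σ M) (.lam σ M')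

/-- `→*`, the reflexive transitive closure of one-step reduction. -/
def Steps : Tm → Tm → Prop := Relation.ReflTransGen Step

end RecLam

namespace RecLam

/-- The universe of primes for the prime-system interpretation of types:
`stag b` is the atom `b ∈ {0,1}` of a separated sum, `spr b a` is the pair `(b,a)`
of a separated sum, `ppr b a` is the pair `(b,a)` of a product, and `fn X a`
is the prime `(X, a)` of a function space (the finite set `X` is represented
as a list). -/
inductive Pm : Type where
  | stag : Bool → Pm
  | spr : Bool → Pm → Pm
  | ppr : Bool → Pm → Pm
  | fn : List Pm → Pm → Pm

/-- The data of a prime system on the universe `Pm`. -/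
structure PData where
  carrier : Set Pm
  con : Pm → Pm → Prop
  le : Pm → Pm → Prop

/-- The elements of a prime system: downward closed, pairwise consistent subsets
of the prime set. -/
def PData.IsElem (A : PData) (d : Set Pm) : Prop :=
  d ⊆ A.carrier ∧ (∀ a b : Pm, A.le a b → b ∈ d → a ∈ d) ∧ ∀ a ∈ d, ∀ b ∈ d, A.con a b

/-- The prime system of the type `void`: no primes. -/
def voidP : PData := ⟨∅, fun _ _ => False, fun _ _ => False⟩

/-- One side `{b} ∪ ({b} × A)` of a separated sum. -/
def sumSideP (A : PData) (b : Bool) : Set Pm :=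
  {p | p = .stag b ∨ ∃ a ∈ A.carrier, p = .spr b a}

/-- The separated sum of prime systems. -/
def sumP (A B : PData) : PData where
  carrier := sumSideP A false ∪ sumSideP B true
  con x y :=
    (x ∈ sumSideP A false ∧ y ∈ sumSideP A false ∧
      ∀ a b, x = .spr false a → y = .spr false b → A.con a b) ∨
    (x ∈ sumSideP B true ∧ y ∈ sumSideP B true ∧
      ∀ a b, x = .spr true a → y = .spr true b → B.con a b)
  le x y :=
    (x = .stag false ∧ y ∈ sumSideP A false) ∨
    (x = .stag true ∧ y ∈ sumSideP B true) ∨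
    (∃ a b, x = .spr false a ∧ y = .spr false b ∧ A.le a b) ∨
    (∃ a b, x = .spr true a ∧ y = .spr true b ∧ B.le a b)

/-- The cartesian product of prime systems. -/
def prodP (A B : PData) : PData where
  carrier := {p | (∃ a ∈ A.carrier, p = .ppr false a) ∨ ∃ b ∈ B.carrier, p = .ppr true b}
  con x y :=
    (∃ a b, x = .ppr false a ∧ y = .ppr false b ∧ A.con a b) ∨
    (∃ a b, x = .ppr true a ∧ y = .ppr true b ∧ B.con a b) ∨
    (∃ a b, x = .ppr false a ∧ y = .ppr true b ∧ a ∈ A.carrier ∧ b ∈ B.carrier) ∨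
    (∃ a b, x = .ppr true a ∧ y = .ppr false b ∧ a ∈ B.carrier ∧ b ∈ A.carrier)
  le x y :=
    (∃ a b, x = .ppr false a ∧ y = .ppr false b ∧ A.le a b) ∨
    (∃ a b, x = .ppr true a ∧ y = .ppr true b ∧ B.le a b)

/-- `X ∈ Ā`: the (finite) list `X` consists of primes of `A` that are pairwise
consistent and pairwise incomparable. -/
def goodList (A : PData) (X : List Pm) : Prop :=
  (∀ x ∈ X, x ∈ A.carrier) ∧ ∀ x ∈ X, ∀ y ∈ X, A.con x y ∧ (A.le x y → x = y)

/-- The function-space prime system `A → B`. -/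
def funcP (A B : PData) : PData where
  carrier := {p | ∃ X a, p = .fn X a ∧ goodList A X ∧ a ∈ B.carrier}
  con x y := ∃ X a Y b, x = .fn X a ∧ y = .fn Y b ∧
    goodList A X ∧ a ∈ B.carrier ∧ goodList A Y ∧ b ∈ B.carrier ∧
    ((∀ u ∈ X, ∀ v ∈ Y, A.con u v) → B.con a b)
  le x y := ∃ X a Y b, x = .fn X a ∧ y = .fn Y b ∧
    goodList A X ∧ a ∈ B.carrier ∧ goodList A Y ∧ b ∈ B.carrier ∧
    (∀ v ∈ Y, ∃ u ∈ X, A.le v u) ∧ B.le a b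

/-- Interpretation of simple types as prime systems. -/
def interpSimple : TyExpr → PData
  | .void => voidP
  | .tvar _ => voidP
  | .mu _ _ => voidP
  | .sum a b => sumP (interpSimple a) (interpSimple b)
  | .prod a b => prodP (interpSimple a) (interpSimple b)
  | .arrow a b => funcP (interpSimple a) (interpSimple b)

/-- The prime-system interpretation `P(τ*)` of a type `τ`: the lub (union) of the
interpretations of the simple prefixes of the unfoldings of `τ` (this directed
union equals the lub of the chain of finite approximations of the type tree
`τ*`). -/
def tyInterp (τ : TyExpr) : PData where
  carrier := {p | ∃ σ ∈ unfolding τ, p ∈ (interpSimple σ).carrier}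
  con x y := ∃ σ ∈ unfolding τ, (interpSimple σ).con x y
  le x y := ∃ σ ∈ unfolding τ, (interpSimple σ).le x y

/-- Application `|r|(d)` of (the function associated with) a set `r` of
function-space primes to a set `d` of primes. -/
def aps (r d : Set Pm) : Set Pm :=
  {b | ∃ X : List Pm, (∀ x ∈ X, x ∈ d) ∧ Pm.fn X b ∈ r}

/-- The downward closure `↓X` of a finite set (list) of primes in `A`. -/
def downListP (A : PData) (X : List Pm) : Set Pm := {a | ∃ x ∈ X, A.le a x}

/-- `Pr(f) = {(X, a) ∣ X ∈ Ā ∧ a ∈ f(↓X)}`, the element of a function-space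
prime system associated with a function `f` (on sets of primes of `A`). -/
def PrOf (A : PData) (f : Set Pm → Set Pm) : Set Pm :=
  {p | ∃ X a, p = Pm.fn X a ∧ goodList A X ∧ a ∈ f (downListP A X)}

/-- Semantic injection `0`: `d ↦ {0} ∪ ({0} × d)`. -/
def inj0 (d : Set Pm) : Set Pm := {p | p = .stag false ∨ ∃ a ∈ d, p = .spr false a}

/-- Semantic injection `1`: `d ↦ {1} ∪ ({1} × d)`. -/
def inj1 (d : Set Pm) : Set Pm := {p | p = .stag true ∨ ∃ a ∈ d, p = .spr true a}

/-- Semantic pairing: `(d, e) ↦ ({0} × d) ∪ ({1} × e)`. -/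
def pairS (d e : Set Pm) : Set Pm :=
  {p | (∃ a ∈ d, p = .ppr false a) ∨ ∃ b ∈ e, p = .ppr true b}

/-- First projection. -/
def fstS (d : Set Pm) : Set Pm := {a | Pm.ppr false a ∈ d}

/-- Second projection. -/
def sndS (d : Set Pm) : Set Pm := {a | Pm.ppr true a ∈ d}

/-- The component `e` of a sum element `0e` (resp. `1e`). -/
def prj0 (d : Set Pm) : Set Pm := {a | Pm.spr false a ∈ d}
def prj1 (d : Set Pm) : Set Pm := {a | Pm.spr true a ∈ d}

/-- The (strict) `case` function: `⊥` if `d = ⊥`, `|f|e` if `d = 0e`,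
`|g|e` if `d = 1e`. -/
def caseS (d f g : Set Pm) : Set Pm :=
  {b | (Pm.stag false ∈ d ∧ b ∈ aps f (prj0 d)) ∨ (Pm.stag true ∈ d ∧ b ∈ aps g (prj1 d))}

/-- The parallel `pcase` function: `b ∩ c` if `a = ⊥`, `b` if `a = 0a'`,
`c` if `a = 1a'`. -/
def pcaseS (a b c : Set Pm) : Set Pm :=
  {p | (Pm.stag false ∉ a ∧ Pm.stag true ∉ a ∧ p ∈ b ∩ c) ∨
       (Pm.stag false ∈ a ∧ p ∈ b) ∨ (Pm.stag true ∈ a ∧ p ∈ c)}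

/-- The semantics of the constants (the semantic functions are transported into
the domains by `Pr` and its curried variants). -/
def constSem : Const → Set Pm
  | .czero σ _ => PrOf (tyInterp σ) inj0
  | .cone _ τ => PrOf (tyInterp τ) inj1
  | .ccase σ τ ρ =>
      PrOf (tyInterp (.sum σ τ)) fun d =>
        PrOf (tyInterp (.arrow σ ρ)) fun f =>
          PrOf (tyInterp (.arrow τ ρ)) fun g => caseS d f g
  | .cpcase σ τ ρ =>
      PrOf (tyInterp (.sum σ τ)) fun a =>
        PrOf (tyInterp ρ) fun b =>
          PrOf (tyInterp ρ) fun c => pcaseS a b c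
  | .cpair σ τ =>
      PrOf (tyInterp σ) fun d => PrOf (tyInterp τ) fun e => pairS d e
  | .cfst σ τ => PrOf (tyInterp (.prod σ τ)) fstS
  | .csnd σ τ => PrOf (tyInterp (.prod σ τ)) sndS
  | .comega _ => ∅

/-- Environments assign a domain element (a set of primes) to every de Bruijn
variable. -/
def Env : Type := ℕ → Set Pm

/-- Extend an environment by a value for the variable `0` (de Bruijn cons). -/
def envCons (d : Set Pm) (ε : Env) : Env :=
  fun n => match n with
  | 0 => d
  | n + 1 => ε n

/-- The denotational semantics `⟦M⟧ε` of a term. -/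
def sem : Tm → Env → Set Pm
  | .var n, ε => ε n
  | .const c, _ => constSem c
  | .app M N, ε => aps (sem M ε) (sem N ε)
  | .lam σ M, ε => PrOf (tyInterp σ) fun d => sem M (envCons d ε)

/-- An environment is typed by a context `Γ` iff it maps each variable to an
element of the domain of its type. -/
def GoodEnv (Γ : List TyExpr) (ε : Env) : Prop :=
  ∀ (n : ℕ) (σ : TyExpr), Γ[n]? = some σ → (tyInterp σ).IsElem (ε n)

/-- The environment assigning `⊥ = ∅` to every variable. -/
def botEnv : Env := fun _ => ∅

end RecLam

namespace RecLam

/-! ### Helper lemmas -/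

/-- Laws of a prime system. -/
structure Lawful (A : PData) : Prop where
  le_car : ∀ a b, A.le a b → a ∈ A.carrier ∧ b ∈ A.carrier
  con_car : ∀ a b, A.con a b → a ∈ A.carrier ∧ b ∈ A.carrier
  le_refl : ∀ a ∈ A.carrier, A.le a a
  con_refl : ∀ a ∈ A.carrier, A.con a a
  con_symm : ∀ a b, A.con a b → A.con b a
  le_trans : ∀ a b c, A.le a b → A.le b c → A.le a c
  con_down : ∀ a a' b, A.le a a' → A.con a' b → A.con a b

/-- The substructure relation. -/
structure Sub (A B : PData) : Prop where
  car : ∀ x ∈ A.carrier, x ∈ B.carrier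
  con : ∀ x y, A.con x y ↔ x ∈ A.carrier ∧ y ∈ A.carrier ∧ B.con x y
  le : ∀ x y, A.le x y ↔ x ∈ A.carrier ∧ y ∈ A.carrier ∧ B.le x y

theorem lawful_void : Lawful voidP := by
  constructor <;> simp [voidP]

theorem lawful_sum {A B : PData} (hA : Lawful A) (hB : Lawful B) : Lawful (sumP A B) := by
  obtain ⟨a1, a2, a3, a4, a5, a6, a7⟩ := hA
  obtain ⟨b1, b2, b3, b4, b5, b6, b7⟩ := hB
  constructor
  · rintro x y (⟨rfl, h⟩ | ⟨rfl, h⟩ | ⟨a, b, rfl, rfl, h⟩ | ⟨a, b, rfl, rfl, h⟩)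
    · exact ⟨Or.inl (Or.inl rfl), Or.inl h⟩
    · exact ⟨Or.inr (Or.inl rfl), Or.inr h⟩
    · exact ⟨Or.inl (Or.inr ⟨_, (a1 _ _ h).1, rfl⟩), Or.inl (Or.inr ⟨_, (a1 _ _ h).2, rfl⟩)⟩
    · exact ⟨Or.inr (Or.inr ⟨_, (b1 _ _ h).1, rfl⟩), Or.inr (Or.inr ⟨_, (b1 _ _ h).2, rfl⟩)⟩
  · rintro x y (⟨h1, h2, -⟩ | ⟨h1, h2, -⟩)
    · exact ⟨Or.inl h1, Or.inl h2⟩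
    · exact ⟨Or.inr h1, Or.inr h2⟩
  · rintro x ((rfl | ⟨a, h, rfl⟩) | (rfl | ⟨a, h, rfl⟩))
    · exact Or.inl ⟨rfl, Or.inl rfl⟩
    · exact Or.inr (Or.inr (Or.inl ⟨_, _, rfl, rfl, a3 _ h⟩))
    · exact Or.inr (Or.inl ⟨rfl, Or.inl rfl⟩)
    · exact Or.inr (Or.inr (Or.inr ⟨_, _, rfl, rfl, b3 _ h⟩))
  · rintro x (h | h)
    · refine Or.inl ⟨h, h, ?_⟩
      rintro a b rfl h2
      simp [sumSideP] at h h2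
      subst h2
      exact a4 _ h
    · refine Or.inr ⟨h, h, ?_⟩
      rintro a b rfl h2
      simp [sumSideP] at h h2
      subst h2
      exact b4 _ h
  · rintro x y (⟨h1, h2, h⟩ | ⟨h1, h2, h⟩)
    · exact Or.inl ⟨h2, h1, fun a b ha hb => a5 _ _ (h _ _ hb ha)⟩
    · exact Or.inr ⟨h2, h1, fun a b ha hb => b5 _ _ (h _ _ hb ha)⟩
  · rintro x y z (⟨rfl, h⟩ | ⟨rfl, h⟩ | ⟨a, b, rfl, rfl, h⟩ | ⟨a, b, rfl, rfl, h⟩)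
      (⟨e, h'⟩ | ⟨e, h'⟩ | ⟨a', b', e, rfl, h'⟩ | ⟨a', b', e, rfl, h'⟩) <;>
      simp_all [sumP, sumSideP]
    · exact (a1 _ _ h').2
    · exact (b1 _ _ h').2
    · exact a6 _ _ _ h h'
    · exact b6 _ _ _ h h'
  · rintro x y z (⟨rfl, h⟩ | ⟨rfl, h⟩ | ⟨a, b, rfl, rfl, h⟩ | ⟨a, b, rfl, rfl, h⟩)
      (⟨h1, h2, h3⟩ | ⟨h1, h2, h3⟩)
    · exact Or.inl ⟨Or.inl rfl, h2, by simp⟩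
    · exfalso
      rcases h with rfl | ⟨_, _, rfl⟩ <;> simp [sumSideP] at h1
    · exfalso
      rcases h with rfl | ⟨_, _, rfl⟩ <;> simp [sumSideP] at h1
    · exact Or.inr ⟨Or.inl rfl, h2, by simp⟩
    · refine Or.inl ⟨Or.inr ⟨_, (a1 _ _ h).1, rfl⟩, h2, ?_⟩
      rintro u v e rfl
      cases e
      exact a7 _ _ _ h (h3 _ _ rfl rfl)
    · simp [sumSideP] at h1
    · simp [sumSideP] at h1
    · refine Or.inr ⟨Or.inr ⟨_, (b1 _ _ h).1, rfl⟩, h2, ?_⟩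
      rintro u v e rfl
      cases e
      exact b7 _ _ _ h (h3 _ _ rfl rfl)

theorem lawful_prod {A B : PData} (hA : Lawful A) (hB : Lawful B) : Lawful (prodP A B) := by
  obtain ⟨a1, a2, a3, a4, a5, a6, a7⟩ := hA
  obtain ⟨b1, b2, b3, b4, b5, b6, b7⟩ := hB
  constructor
  · rintro x y (⟨a, b, rfl, rfl, h⟩ | ⟨a, b, rfl, rfl, h⟩)
    · simpa [prodP] using a1 _ _ h
    · simpa [prodP] using b1 _ _ h
  · rintro x y (⟨a, b, rfl, rfl, h⟩ | ⟨a, b, rfl, rfl, h⟩ | ⟨a, b, rfl, rfl, h⟩ | ⟨a, b, rfl, rfl, h⟩)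
    · simpa [prodP] using a2 _ _ h
    · simpa [prodP] using b2 _ _ h
    · simpa [prodP] using h
    · simpa [prodP] using h
  · rintro x (⟨a, h, rfl⟩ | ⟨a, h, rfl⟩)
    · simpa [prodP] using a3 _ h
    · simpa [prodP] using b3 _ h
  · rintro x (⟨a, h, rfl⟩ | ⟨a, h, rfl⟩)
    · simpa [prodP] using a4 _ h
    · simpa [prodP] using b4 _ h
  · rintro x y (⟨a, b, rfl, rfl, h⟩ | ⟨a, b, rfl, rfl, h⟩ | ⟨a, b, rfl, rfl, h⟩ | ⟨a, b, rfl, rfl, h⟩)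
    · simpa [prodP] using a5 _ _ h
    · simpa [prodP] using b5 _ _ h
    · simpa [prodP] using h.symm
    · simpa [prodP] using h.symm
  · rintro x y z (⟨a, b, rfl, rfl, h⟩ | ⟨a, b, rfl, rfl, h⟩)
      (⟨a', b', e, rfl, h'⟩ | ⟨a', b', e, rfl, h'⟩) <;> cases e
    · simpa [prodP] using a6 _ _ _ h h'
    · simpa [prodP] using b6 _ _ _ h h'
  · rintro x y z (⟨a, b, rfl, rfl, h⟩ | ⟨a, b, rfl, rfl, h⟩)
      (⟨a', b', e, rfl, h'⟩ | ⟨a', b', e, rfl, h'⟩ | ⟨a', b', e, rfl, h'⟩ | ⟨a', b', e, rfl, h'⟩)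
      <;> cases e
    · simpa [prodP] using a7 _ _ _ h h'
    · simpa [prodP] using ⟨(a1 _ _ h).1, h'.2⟩
    · simpa [prodP] using b7 _ _ _ h h'
    · simpa [prodP] using ⟨(b1 _ _ h).1, h'.2⟩

theorem lawful_func {A B : PData} (hA : Lawful A) (hB : Lawful B) : Lawful (funcP A B) := by
  obtain ⟨a1, a2, a3, a4, a5, a6, a7⟩ := hA
  obtain ⟨b1, b2, b3, b4, b5, b6, b7⟩ := hB
  constructor
  · rintro x y ⟨X, a, Y, b, rfl, rfl, hX, ha, hY, hb, -⟩
    exact ⟨⟨_, _, rfl, hX, ha⟩, ⟨_, _, rfl, hY, hb⟩⟩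
  · rintro x y ⟨X, a, Y, b, rfl, rfl, hX, ha, hY, hb, -⟩
    exact ⟨⟨_, _, rfl, hX, ha⟩, ⟨_, _, rfl, hY, hb⟩⟩
  · rintro x ⟨X, a, rfl, hX, ha⟩
    exact ⟨_, _, _, _, rfl, rfl, hX, ha, hX, ha, fun v hv => ⟨v, hv, a3 _ (hX.1 v hv)⟩, b3 _ ha⟩
  · rintro x ⟨X, a, rfl, hX, ha⟩
    exact ⟨_, _, _, _, rfl, rfl, hX, ha, hX, ha, fun _ => b4 _ ha⟩
  · rintro x y ⟨X, a, Y, b, rfl, rfl, hX, ha, hY, hb, h⟩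
    exact ⟨_, _, _, _, rfl, rfl, hY, hb, hX, ha,
      fun h' => b5 _ _ (h fun u hu v hv => a5 _ _ (h' v hv u hu))⟩
  · rintro x y z ⟨X, a, Y, b, rfl, rfl, hX, ha, hY, hb, h, h1⟩
      ⟨Y', b', Z, c, e, rfl, hY', hb', hZ, hc, h', h1'⟩
    cases e
    refine ⟨_, _, _, _, rfl, rfl, hX, ha, hZ, hc, ?_, b6 _ _ _ h1 h1'⟩
    intro v hv
    obtain ⟨u, hu, huv⟩ := h' v hv
    obtain ⟨w, hw, hwu⟩ := h u hu
    exact ⟨w, hw, a6 _ _ _ huv hwu⟩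
  · rintro x y z ⟨X, a, Y, b, rfl, rfl, hX, ha, hY, hb, h, h1⟩
      ⟨Y', b', Z, c, e, rfl, hY', hb', hZ, hc, h'⟩
    cases e
    refine ⟨_, _, _, _, rfl, rfl, hX, ha, hZ, hc, fun hc => b7 _ _ _ h1 (h' ?_)⟩
    intro u hu v hv
    obtain ⟨w, hw, hwu⟩ := h u hu
    exact a7 _ _ _ hwu (hc w hw v hv)

theorem lawful_simple : ∀ σ : TyExpr, Lawful (interpSimple σ)
  | .void => lawful_void
  | .tvar _ => lawful_void
  | .mu _ _ => lawful_void
  | .sum a b => lawful_sum (lawful_simple a) (lawful_simple b)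
  | .prod a b => lawful_prod (lawful_simple a) (lawful_simple b)
  | .arrow a b => lawful_func (lawful_simple a) (lawful_simple b)

theorem sub_void (A : PData) : Sub voidP A := by
  constructor <;> simp [voidP]

theorem sumSide_mono {A A' : PData} (h : Sub A A') {b : Bool} {x : Pm}
    (hx : x ∈ sumSideP A b) : x ∈ sumSideP A' b := by
  rcases hx with rfl | ⟨a, ha, rfl⟩
  · exact Or.inl rfl
  · exact Or.inr ⟨_, h.car _ ha, rfl⟩

theorem sumSide_disj {A B : PData} {x : Pm}
    (hx : x ∈ sumSideP A false) (hy : x ∈ sumSideP B true) : False := by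
  rcases hx with rfl | ⟨a, ha, rfl⟩ <;> simp [sumSideP] at hy

theorem sub_sum {A A' B B' : PData} (hA : Sub A A') (hB : Sub B B') :
    Sub (sumP A B) (sumP A' B') := by
  constructor
  · rintro x (h | h)
    · exact Or.inl (sumSide_mono hA h)
    · exact Or.inr (sumSide_mono hB h)
  · intro x y
    constructor
    · rintro (⟨h1, h2, h⟩ | ⟨h1, h2, h⟩)
      · exact ⟨Or.inl h1, Or.inl h2, Or.inl ⟨sumSide_mono hA h1, sumSide_mono hA h2,
          fun a b e f => ((hA.con _ _).1 (h a b e f)).2.2⟩⟩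
      · exact ⟨Or.inr h1, Or.inr h2, Or.inr ⟨sumSide_mono hB h1, sumSide_mono hB h2,
          fun a b e f => ((hB.con _ _).1 (h a b e f)).2.2⟩⟩
    · rintro ⟨h1, h2, (⟨h3, h4, h⟩ | ⟨h3, h4, h⟩)⟩
      · have h1 := h1.resolve_right (sumSide_disj h3)
        have h2 := h2.resolve_right (sumSide_disj h4)
        refine Or.inl ⟨h1, h2, fun a b e f => (hA.con _ _).2 ⟨?_, ?_, h a b e f⟩⟩
        · subst e; simpa [sumSideP] using h1
        · subst f; simpa [sumSideP] using h2
      · have h1 := h1.resolve_left (fun h => sumSide_disj h h3)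
        have h2 := h2.resolve_left (fun h => sumSide_disj h h4)
        refine Or.inr ⟨h1, h2, fun a b e f => (hB.con _ _).2 ⟨?_, ?_, h a b e f⟩⟩
        · subst e; simpa [sumSideP] using h1
        · subst f; simpa [sumSideP] using h2
  · intro x y
    constructor
    · rintro (⟨rfl, h⟩ | ⟨rfl, h⟩ | ⟨a, b, rfl, rfl, h⟩ | ⟨a, b, rfl, rfl, h⟩)
      · exact ⟨Or.inl (Or.inl rfl), Or.inl h, Or.inl ⟨rfl, sumSide_mono hA h⟩⟩
      · exact ⟨Or.inr (Or.inl rfl), Or.inr h, Or.inr (Or.inl ⟨rfl, sumSide_mono hB h⟩)⟩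
      · have := (hA.le _ _).1 h
        simpa [sumP, sumSideP] using this
      · have := (hB.le _ _).1 h
        simpa [sumP, sumSideP] using this
    · rintro ⟨h1, h2, (⟨rfl, h⟩ | ⟨rfl, h⟩ | ⟨a, b, rfl, rfl, h⟩ | ⟨a, b, rfl, rfl, h⟩)⟩
      · exact Or.inl ⟨rfl, h2.resolve_right (sumSide_disj h)⟩
      · exact Or.inr (Or.inl ⟨rfl, h2.resolve_left (fun h' => sumSide_disj h' h)⟩)
      · refine Or.inr (Or.inr (Or.inl ⟨_, _, rfl, rfl, (hA.le _ _).2 ⟨?_, ?_, h⟩⟩))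
        · simpa [sumP, sumSideP] using h1
        · simpa [sumP, sumSideP] using h2
      · refine Or.inr (Or.inr (Or.inr ⟨_, _, rfl, rfl, (hB.le _ _).2 ⟨?_, ?_, h⟩⟩))
        · simpa [sumP, sumSideP] using h1
        · simpa [sumP, sumSideP] using h2

theorem sub_prod {A A' B B' : PData} (hA : Sub A A') (hB : Sub B B') :
    Sub (prodP A B) (prodP A' B') := by
  constructor
  · rintro x (⟨a, h, rfl⟩ | ⟨a, h, rfl⟩)
    · exact Or.inl ⟨_, hA.car _ h, rfl⟩
    · exact Or.inr ⟨_, hB.car _ h, rfl⟩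
  · intro x y
    constructor
    · rintro (⟨a, b, rfl, rfl, h⟩ | ⟨a, b, rfl, rfl, h⟩ | ⟨a, b, rfl, rfl, h⟩ | ⟨a, b, rfl, rfl, h⟩)
      · simpa [prodP] using (hA.con _ _).1 h
      · simpa [prodP] using (hB.con _ _).1 h
      · simpa [prodP] using ⟨h.1, h.2, hA.car _ h.1, hB.car _ h.2⟩
      · simpa [prodP] using ⟨h.1, h.2, hB.car _ h.1, hA.car _ h.2⟩
    · rintro ⟨h1, h2, (⟨a, b, rfl, rfl, h⟩ | ⟨a, b, rfl, rfl, h⟩ | ⟨a, b, rfl, rfl, h⟩ |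
        ⟨a, b, rfl, rfl, h⟩)⟩ <;> simp [prodP] at h1 h2
      · simpa [prodP] using (hA.con _ _).2 ⟨h1, h2, h⟩
      · simpa [prodP] using (hB.con _ _).2 ⟨h1, h2, h⟩
      · simpa [prodP] using ⟨h1, h2⟩
      · simpa [prodP] using ⟨h1, h2⟩
  · intro x y
    constructor
    · rintro (⟨a, b, rfl, rfl, h⟩ | ⟨a, b, rfl, rfl, h⟩)
      · simpa [prodP] using (hA.le _ _).1 h
      · simpa [prodP] using (hB.le _ _).1 h
    · rintro ⟨h1, h2, (⟨a, b, rfl, rfl, h⟩ | ⟨a, b, rfl, rfl, h⟩)⟩ <;> simp [prodP] at h1 h2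
      · simpa [prodP] using (hA.le _ _).2 ⟨h1, h2, h⟩
      · simpa [prodP] using (hB.le _ _).2 ⟨h1, h2, h⟩

theorem sub_good {A A' : PData} (hA : Sub A A') (X : List Pm) :
    goodList A X ↔ (∀ x ∈ X, x ∈ A.carrier) ∧ goodList A' X := by
  constructor
  · rintro ⟨h1, h2⟩
    refine ⟨h1, fun x hx => hA.car _ (h1 x hx), fun x hx y hy => ⟨?_, fun h => ?_⟩⟩
    · exact ((hA.con _ _).1 (h2 x hx y hy).1).2.2
    · exact (h2 x hx y hy).2 ((hA.le _ _).2 ⟨h1 x hx, h1 y hy, h⟩)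
  · rintro ⟨h1, -, h2⟩
    refine ⟨h1, fun x hx y hy => ⟨?_, fun h => ?_⟩⟩
    · exact (hA.con _ _).2 ⟨h1 x hx, h1 y hy, (h2 x hx y hy).1⟩
    · exact (h2 x hx y hy).2 ((hA.le _ _).1 h).2.2

theorem sub_func {A A' B B' : PData} (hA : Sub A A') (hB : Sub B B') :
    Sub (funcP A B) (funcP A' B') := by
  constructor
  · rintro x ⟨X, a, rfl, hX, ha⟩
    exact ⟨_, _, rfl, ((sub_good hA X).1 hX).2, hB.car _ ha⟩
  · intro x y
    constructor
    · rintro ⟨X, a, Y, b, rfl, rfl, hX, ha, hY, hb, h⟩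
      refine ⟨⟨_, _, rfl, hX, ha⟩, ⟨_, _, rfl, hY, hb⟩, _, _, _, _, rfl, rfl,
        ((sub_good hA X).1 hX).2, hB.car _ ha, ((sub_good hA Y).1 hY).2, hB.car _ hb, ?_⟩
      intro h'
      exact ((hB.con _ _).1 (h fun u hu v hv =>
        (hA.con _ _).2 ⟨hX.1 u hu, hY.1 v hv, h' u hu v hv⟩)).2.2
    · rintro ⟨⟨X, a, rfl, hX, ha⟩, ⟨Y, b, rfl, hY, hb⟩, X', a', Y', b', e1, e2, -, -, -, -, h⟩
      cases e1; cases e2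
      refine ⟨_, _, _, _, rfl, rfl, hX, ha, hY, hb, fun h' => ?_⟩
      exact (hB.con _ _).2 ⟨ha, hb, h fun u hu v hv => ((hA.con _ _).1 (h' u hu v hv)).2.2⟩
  · intro x y
    constructor
    · rintro ⟨X, a, Y, b, rfl, rfl, hX, ha, hY, hb, h, h1⟩
      refine ⟨⟨_, _, rfl, hX, ha⟩, ⟨_, _, rfl, hY, hb⟩, _, _, _, _, rfl, rfl,
        ((sub_good hA X).1 hX).2, hB.car _ ha, ((sub_good hA Y).1 hY).2, hB.car _ hb, ?_,
        ((hB.le _ _).1 h1).2.2⟩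
      intro v hv
      obtain ⟨u, hu, huv⟩ := h v hv
      exact ⟨u, hu, ((hA.le _ _).1 huv).2.2⟩
    · rintro ⟨⟨X, a, rfl, hX, ha⟩, ⟨Y, b, rfl, hY, hb⟩, X', a', Y', b', e1, e2, -, -, -, -, h, h1⟩
      cases e1; cases e2
      refine ⟨_, _, _, _, rfl, rfl, hX, ha, hY, hb, ?_, (hB.le _ _).2 ⟨ha, hb, h1⟩⟩
      intro v hv
      obtain ⟨u, hu, huv⟩ := h v hv
      exact ⟨u, hu, (hA.le _ _).2 ⟨hY.1 v hv, hX.1 u hu, huv⟩⟩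

theorem pre_sub {σ τ : TyExpr} (h : Pre σ τ) : Sub (interpSimple σ) (interpSimple τ) := by
  induction h with
  | void τ => exact sub_void _
  | sum _ _ h1 h2 => exact sub_sum h1 h2
  | prod _ _ h1 h2 => exact sub_prod h1 h2
  | arrow _ _ h1 h2 => exact sub_func h1 h2

/-! ### Unfoldings -/

theorem unfold_diamond {a b : TyExpr} (h : Unfold a b) : ∀ c, Unfold a c →
    ∃ d, Relation.ReflGen Unfold b d ∧ Relation.ReflGen Unfold c d := by
  induction h with
  | mu t a =>
    intro c hc
    cases hc
    exact ⟨_, .refl, .refl⟩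
  | sumL b h ih =>
    intro c hc
    cases hc with
    | sumL _ h' =>
      obtain ⟨d, h1, h2⟩ := ih _ h'
      refine ⟨.sum d b, ?_, ?_⟩
      · cases h1 with
        | refl => exact .refl
        | single h => exact .single (.sumL _ h)
      · cases h2 with
        | refl => exact .refl
        | single h => exact .single (.sumL _ h)
    | sumR _ h' => exact ⟨_, .single (.sumR _ h'), .single (.sumL _ h)⟩
  | sumR b h ih =>
    intro c hc
    cases hc with
    | sumR _ h' =>
      obtain ⟨d, h1, h2⟩ := ih _ h'
      refine ⟨.sum b d, ?_, ?_⟩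
      · cases h1 with
        | refl => exact .refl
        | single h => exact .single (.sumR _ h)
      · cases h2 with
        | refl => exact .refl
        | single h => exact .single (.sumR _ h)
    | sumL _ h' => exact ⟨_, .single (.sumL _ h'), .single (.sumR _ h)⟩
  | prodL b h ih =>
    intro c hc
    cases hc with
    | prodL _ h' =>
      obtain ⟨d, h1, h2⟩ := ih _ h'
      refine ⟨.prod d b, ?_, ?_⟩
      · cases h1 with
        | refl => exact .refl
        | single h => exact .single (.prodL _ h)
      · cases h2 with
        | refl => exact .refl
        | single h => exact .single (.prodL _ h)
    | prodR _ h' => exact ⟨_, .single (.prodR _ h'), .single (.prodL _ h)⟩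
  | prodR b h ih =>
    intro c hc
    cases hc with
    | prodR _ h' =>
      obtain ⟨d, h1, h2⟩ := ih _ h'
      refine ⟨.prod b d, ?_, ?_⟩
      · cases h1 with
        | refl => exact .refl
        | single h => exact .single (.prodR _ h)
      · cases h2 with
        | refl => exact .refl
        | single h => exact .single (.prodR _ h)
    | prodL _ h' => exact ⟨_, .single (.prodL _ h'), .single (.prodR _ h)⟩
  | arrowL b h ih =>
    intro c hc
    cases hc with
    | arrowL _ h' =>
      obtain ⟨d, h1, h2⟩ := ih _ h'
      refine ⟨.arrow d b, ?_, ?_⟩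
      · cases h1 with
        | refl => exact .refl
        | single h => exact .single (.arrowL _ h)
      · cases h2 with
        | refl => exact .refl
        | single h => exact .single (.arrowL _ h)
    | arrowR _ h' => exact ⟨_, .single (.arrowR _ h'), .single (.arrowL _ h)⟩
  | arrowR b h ih =>
    intro c hc
    cases hc with
    | arrowR _ h' =>
      obtain ⟨d, h1, h2⟩ := ih _ h'
      refine ⟨.arrow b d, ?_, ?_⟩
      · cases h1 with
        | refl => exact .refl
        | single h => exact .single (.arrowR _ h)
      · cases h2 with
        | refl => exact .refl
        | single h => exact .single (.arrowR _ h)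
    | arrowL _ h' => exact ⟨_, .single (.arrowL _ h'), .single (.arrowR _ h)⟩

theorem pre_unfold {τ τ' : TyExpr} (h : Unfold τ τ') : ∀ σ, Pre σ τ → Pre σ τ' := by
  induction h with
  | mu t a => intro σ hσ; cases hσ; exact .void _
  | sumL b h ih =>
    intro σ hσ
    cases hσ with
    | void => exact .void _
    | sum h1 h2 => exact .sum (ih _ h1) h2
  | sumR b h ih =>
    intro σ hσ
    cases hσ with
    | void => exact .void _
    | sum h1 h2 => exact .sum h1 (ih _ h2)
  | prodL b h ih =>
    intro σ hσ
    cases hσ with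
    | void => exact .void _
    | prod h1 h2 => exact .prod (ih _ h1) h2
  | prodR b h ih =>
    intro σ hσ
    cases hσ with
    | void => exact .void _
    | prod h1 h2 => exact .prod h1 (ih _ h2)
  | arrowL b h ih =>
    intro σ hσ
    cases hσ with
    | void => exact .void _
    | arrow h1 h2 => exact .arrow (ih _ h1) h2
  | arrowR b h ih =>
    intro σ hσ
    cases hσ with
    | void => exact .void _
    | arrow h1 h2 => exact .arrow h1 (ih _ h2)

theorem pre_unfolds {τ τ' : TyExpr} (h : Unfolds τ τ') {σ : TyExpr} (hσ : Pre σ τ) :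
    Pre σ τ' := by
  induction h with
  | refl => exact hσ
  | tail _ h ih => exact pre_unfold h _ ih

/-- Replace all `μ`s and type variables by `void`. -/
def er : TyExpr → TyExpr
  | .void => .void
  | .tvar _ => .void
  | .mu _ _ => .void
  | .sum a b => .sum (er a) (er b)
  | .prod a b => .prod (er a) (er b)
  | .arrow a b => .arrow (er a) (er b)

theorem er_pre : ∀ τ, Pre (er τ) τ
  | .void => .void _
  | .tvar _ => .void _
  | .mu _ _ => .void _
  | .sum a b => .sum (er_pre a) (er_pre b)
  | .prod a b => .prod (er_pre a) (er_pre b)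
  | .arrow a b => .arrow (er_pre a) (er_pre b)

theorem pre_er {σ τ : TyExpr} (h : Pre σ τ) : Pre σ (er τ) := by
  induction h with
  | void τ => exact .void _
  | sum _ _ h1 h2 => exact .sum h1 h2
  | prod _ _ h1 h2 => exact .prod h1 h2
  | arrow _ _ h1 h2 => exact .arrow h1 h2

theorem unf_directed {τ σ₁ σ₂ : TyExpr} (h1 : σ₁ ∈ unfolding τ) (h2 : σ₂ ∈ unfolding τ) :
    ∃ σ₃ ∈ unfolding τ, Pre σ₁ σ₃ ∧ Pre σ₂ σ₃ := by
  obtain ⟨τ₁, u1, p1⟩ := h1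
  obtain ⟨τ₂, u2, p2⟩ := h2
  obtain ⟨τ₃, v1, v2⟩ := Relation.church_rosser (fun a b c hab hac => by
    obtain ⟨d, x, y⟩ := unfold_diamond hab c hac
    exact ⟨d, x, y.to_reflTransGen⟩) u1 u2
  exact ⟨er τ₃, ⟨τ₃, u1.trans v1, er_pre _⟩, pre_er (pre_unfolds v1 p1), pre_er (pre_unfolds v2 p2)⟩

theorem void_unf (τ : TyExpr) : .void ∈ unfolding τ := ⟨τ, .refl, .void _⟩

theorem unfolds_lift (f : TyExpr → TyExpr) (hf : ∀ x y, Unfold x y → Unfold (f x) (f y))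
    {a b : TyExpr} (h : Unfolds a b) : Relation.ReflTransGen Unfold (f a) (f b) := by
  induction h with
  | refl => exact .refl
  | tail _ h ih => exact ih.tail (hf _ _ h)

theorem unf_sum (a b : TyExpr) : unfolding (.sum a b) =
    {σ | σ = .void ∨ ∃ s ∈ unfolding a, ∃ t ∈ unfolding b, σ = .sum s t} := by
  ext σ
  constructor
  · rintro ⟨τ, u, p⟩
    have : ∃ a' b', τ = .sum a' b' ∧ Unfolds a a' ∧ Unfolds b b' := by
      clear p
      induction u with
      | refl => exact ⟨a, b, rfl, .refl, .refl⟩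
      | tail _ h ih =>
        obtain ⟨a', b', rfl, ha, hb⟩ := ih
        cases h with
        | sumL _ h => exact ⟨_, _, rfl, ha.tail h, hb⟩
        | sumR _ h => exact ⟨_, _, rfl, ha, hb.tail h⟩
    obtain ⟨a', b', rfl, ha, hb⟩ := this
    cases p with
    | void => exact Or.inl rfl
    | sum h1 h2 => exact Or.inr ⟨_, ⟨_, ha, h1⟩, _, ⟨_, hb, h2⟩, rfl⟩
  · rintro (rfl | ⟨s, ⟨s', us, ps⟩, t, ⟨t', ut, pt⟩, rfl⟩)
    · exact void_unf _
    · exact ⟨.sum s' t', Relation.ReflTransGen.trans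
        (unfolds_lift (fun x => TyExpr.sum x b) (fun _ _ h => .sumL _ h) us)
        (unfolds_lift (fun x => TyExpr.sum s' x) (fun _ _ h => .sumR _ h) ut),
        .sum ps pt⟩

theorem unf_prod (a b : TyExpr) : unfolding (.prod a b) =
    {σ | σ = .void ∨ ∃ s ∈ unfolding a, ∃ t ∈ unfolding b, σ = .prod s t} := by
  ext σ
  constructor
  · rintro ⟨τ, u, p⟩
    have : ∃ a' b', τ = .prod a' b' ∧ Unfolds a a' ∧ Unfolds b b' := by
      clear p
      induction u with
      | refl => exact ⟨a, b, rfl, .refl, .refl⟩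
      | tail _ h ih =>
        obtain ⟨a', b', rfl, ha, hb⟩ := ih
        cases h with
        | prodL _ h => exact ⟨_, _, rfl, ha.tail h, hb⟩
        | prodR _ h => exact ⟨_, _, rfl, ha, hb.tail h⟩
    obtain ⟨a', b', rfl, ha, hb⟩ := this
    cases p with
    | void => exact Or.inl rfl
    | prod h1 h2 => exact Or.inr ⟨_, ⟨_, ha, h1⟩, _, ⟨_, hb, h2⟩, rfl⟩
  · rintro (rfl | ⟨s, ⟨s', us, ps⟩, t, ⟨t', ut, pt⟩, rfl⟩)
    · exact void_unf _
    · exact ⟨.prod s' t', Relation.ReflTransGen.trans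
        (unfolds_lift (fun x => TyExpr.prod x b) (fun _ _ h => .prodL _ h) us)
        (unfolds_lift (fun x => TyExpr.prod s' x) (fun _ _ h => .prodR _ h) ut),
        .prod ps pt⟩

theorem unf_arrow (a b : TyExpr) : unfolding (.arrow a b) =
    {σ | σ = .void ∨ ∃ s ∈ unfolding a, ∃ t ∈ unfolding b, σ = .arrow s t} := by
  ext σ
  constructor
  · rintro ⟨τ, u, p⟩
    have : ∃ a' b', τ = .arrow a' b' ∧ Unfolds a a' ∧ Unfolds b b' := by
      clear p
      induction u with
      | refl => exact ⟨a, b, rfl, .refl, .refl⟩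
      | tail _ h ih =>
        obtain ⟨a', b', rfl, ha, hb⟩ := ih
        cases h with
        | arrowL _ h => exact ⟨_, _, rfl, ha.tail h, hb⟩
        | arrowR _ h => exact ⟨_, _, rfl, ha, hb.tail h⟩
    obtain ⟨a', b', rfl, ha, hb⟩ := this
    cases p with
    | void => exact Or.inl rfl
    | arrow h1 h2 => exact Or.inr ⟨_, ⟨_, ha, h1⟩, _, ⟨_, hb, h2⟩, rfl⟩
  · rintro (rfl | ⟨s, ⟨s', us, ps⟩, t, ⟨t', ut, pt⟩, rfl⟩)
    · exact void_unf _
    · exact ⟨.arrow s' t', Relation.ReflTransGen.trans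
        (unfolds_lift (fun x => TyExpr.arrow x b) (fun _ _ h => .arrowL _ h) us)
        (unfolds_lift (fun x => TyExpr.arrow s' x) (fun _ _ h => .arrowR _ h) ut),
        .arrow ps pt⟩

theorem TyEquiv.refl (σ : TyExpr) : TyEquiv σ σ := rfl
theorem TyEquiv.symm {σ τ : TyExpr} (h : TyEquiv σ τ) : TyEquiv τ σ := Eq.symm h
theorem TyEquiv.trans {σ τ ρ : TyExpr} (h : TyEquiv σ τ) (h' : TyEquiv τ ρ) : TyEquiv σ ρ :=
  Eq.trans h h'

theorem TyEquiv.arrow {a b a' b' : TyExpr} (h : TyEquiv a a') (h' : TyEquiv b b') :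
    TyEquiv (.arrow a b) (.arrow a' b') := by
  unfold TyEquiv at *
  rw [unf_arrow, unf_arrow, h, h']

theorem TyEquiv.arrow_inv {a b a' b' : TyExpr} (h : TyEquiv (.arrow a b) (.arrow a' b')) :
    TyEquiv a a' ∧ TyEquiv b b' := by
  unfold TyEquiv at *
  rw [unf_arrow, unf_arrow] at h
  refine ⟨Set.ext fun x => ?_, Set.ext fun x => ?_⟩
  · have := Set.ext_iff.1 h (.arrow x .void)
    simpa [void_unf] using this
  · have := Set.ext_iff.1 h (.arrow .void x)
    simpa [void_unf] using this

theorem TyEquiv.sum_inv {a b a' b' : TyExpr} (h : TyEquiv (.sum a b) (.sum a' b')) :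
    TyEquiv a a' ∧ TyEquiv b b' := by
  unfold TyEquiv at *
  rw [unf_sum, unf_sum] at h
  refine ⟨Set.ext fun x => ?_, Set.ext fun x => ?_⟩
  · have := Set.ext_iff.1 h (.sum x .void)
    simpa [void_unf] using this
  · have := Set.ext_iff.1 h (.sum .void x)
    simpa [void_unf] using this

theorem TyEquiv.prod_inv {a b a' b' : TyExpr} (h : TyEquiv (.prod a b) (.prod a' b')) :
    TyEquiv a a' ∧ TyEquiv b b' := by
  unfold TyEquiv at *
  rw [unf_prod, unf_prod] at h
  refine ⟨Set.ext fun x => ?_, Set.ext fun x => ?_⟩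
  · have := Set.ext_iff.1 h (.prod x .void)
    simpa [void_unf] using this
  · have := Set.ext_iff.1 h (.prod .void x)
    simpa [void_unf] using this

theorem TyEquiv.interp {σ τ : TyExpr} (h : TyEquiv σ τ) : tyInterp σ = tyInterp τ := by
  unfold TyEquiv at h
  simp only [tyInterp, h]

/-! ### The interpretation of types -/

theorem sub_ty {τ σ : TyExpr} (h : σ ∈ unfolding τ) : Sub (interpSimple σ) (tyInterp τ) := by
  constructor
  · exact fun x hx => ⟨σ, h, hx⟩
  · intro x y
    constructor
    · intro hc
      exact ⟨((lawful_simple σ).con_car _ _ hc).1, ((lawful_simple σ).con_car _ _ hc).2, σ, h, hc⟩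
    · rintro ⟨hx, hy, σ', h', hc⟩
      obtain ⟨ρ, -, p1, p2⟩ := unf_directed h h'
      exact ((pre_sub p1).con _ _).2 ⟨hx, hy, (((pre_sub p2).con _ _).1 hc).2.2⟩
  · intro x y
    constructor
    · intro hc
      exact ⟨((lawful_simple σ).le_car _ _ hc).1, ((lawful_simple σ).le_car _ _ hc).2, σ, h, hc⟩
    · rintro ⟨hx, hy, σ', h', hc⟩
      obtain ⟨ρ, -, p1, p2⟩ := unf_directed h h'
      exact ((pre_sub p1).le _ _).2 ⟨hx, hy, (((pre_sub p2).le _ _).1 hc).2.2⟩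

theorem ty_two {τ : TyExpr} {x y : Pm} (hx : x ∈ (tyInterp τ).carrier)
    (hy : y ∈ (tyInterp τ).carrier) :
    ∃ σ ∈ unfolding τ, x ∈ (interpSimple σ).carrier ∧ y ∈ (interpSimple σ).carrier := by
  obtain ⟨σ₁, h1, hx⟩ := hx
  obtain ⟨σ₂, h2, hy⟩ := hy
  obtain ⟨ρ, h, p1, p2⟩ := unf_directed h1 h2
  exact ⟨ρ, h, (pre_sub p1).car _ hx, (pre_sub p2).car _ hy⟩

theorem ty_list {τ : TyExpr} (X : List Pm) (hX : ∀ x ∈ X, x ∈ (tyInterp τ).carrier) :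
    ∃ σ ∈ unfolding τ, ∀ x ∈ X, x ∈ (interpSimple σ).carrier := by
  induction X with
  | nil => exact ⟨_, void_unf _, by simp⟩
  | cons a X ih =>
    obtain ⟨σ₁, h1, hx⟩ := hX a (by simp)
    obtain ⟨σ₂, h2, hy⟩ := ih fun x hx => hX x (by simp [hx])
    obtain ⟨ρ, h, p1, p2⟩ := unf_directed h1 h2
    refine ⟨ρ, h, fun x hx' => ?_⟩
    rcases List.mem_cons.1 hx' with rfl | hx'
    · exact (pre_sub p1).car _ hx
    · exact (pre_sub p2).car _ (hy _ hx')

theorem lawful_ty (τ : TyExpr) : Lawful (tyInterp τ) := by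
  have lc : ∀ a b, (tyInterp τ).le a b → a ∈ (tyInterp τ).carrier ∧ b ∈ (tyInterp τ).carrier := by
    rintro a b ⟨σ, h, hc⟩
    have := (lawful_simple σ).le_car _ _ hc
    exact ⟨⟨σ, h, this.1⟩, ⟨σ, h, this.2⟩⟩
  have cc : ∀ a b, (tyInterp τ).con a b → a ∈ (tyInterp τ).carrier ∧ b ∈ (tyInterp τ).carrier := by
    rintro a b ⟨σ, h, hc⟩
    have := (lawful_simple σ).con_car _ _ hc
    exact ⟨⟨σ, h, this.1⟩, ⟨σ, h, this.2⟩⟩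
  constructor
  · exact lc
  · exact cc
  · rintro a ⟨σ, h, ha⟩
    exact ⟨σ, h, (lawful_simple σ).le_refl _ ha⟩
  · rintro a ⟨σ, h, ha⟩
    exact ⟨σ, h, (lawful_simple σ).con_refl _ ha⟩
  · rintro a b ⟨σ, h, hc⟩
    exact ⟨σ, h, (lawful_simple σ).con_symm _ _ hc⟩
  · intro a b c h1 h2
    obtain ⟨σ, h, hm⟩ := ty_list (τ := τ) [a, b, c] (by
      simp [(lc _ _ h1).1, (lc _ _ h1).2, (lc _ _ h2).2])
    simp at hm
    exact ⟨σ, h, (lawful_simple σ).le_trans _ b _ (((sub_ty h).le _ _).2 ⟨hm.1, hm.2.1, h1⟩)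
      (((sub_ty h).le _ _).2 ⟨hm.2.1, hm.2.2, h2⟩)⟩
  · intro a b c h1 h2
    obtain ⟨σ, h, hm⟩ := ty_list (τ := τ) [a, b, c] (by
      simp [(lc _ _ h1).1, (lc _ _ h1).2, (cc _ _ h2).2])
    simp at hm
    exact ⟨σ, h, (lawful_simple σ).con_down _ b _ (((sub_ty h).le _ _).2 ⟨hm.1, hm.2.1, h1⟩)
      (((sub_ty h).con _ _).2 ⟨hm.2.1, hm.2.2, h2⟩)⟩

theorem ty_eq {τ : TyExpr} {Q : PData} (hQ : Lawful Q)
    (hs : ∀ σ ∈ unfolding τ, Sub (interpSimple σ) Q)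
    (hc : ∀ x ∈ Q.carrier, x ∈ (tyInterp τ).carrier) : tyInterp τ = Q := by
  have h1 : (tyInterp τ).carrier = Q.carrier := by
    ext x
    refine ⟨?_, hc x⟩
    rintro ⟨σ, h, hx⟩
    exact (hs σ h).car _ hx
  have h2 : (tyInterp τ).con = Q.con := by
    funext x y
    refine propext ⟨?_, fun h => ?_⟩
    · rintro ⟨σ, h, hx⟩
      exact (((hs σ h).con _ _).1 hx).2.2
    · have := hQ.con_car _ _ h
      obtain ⟨σ, hσ, hx, hy⟩ := ty_two (hc _ this.1) (hc _ this.2)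
      exact ⟨σ, hσ, ((hs σ hσ).con _ _).2 ⟨hx, hy, h⟩⟩
  have h3 : (tyInterp τ).le = Q.le := by
    funext x y
    refine propext ⟨?_, fun h => ?_⟩
    · rintro ⟨σ, h, hx⟩
      exact (((hs σ h).le _ _).1 hx).2.2
    · have := hQ.le_car _ _ h
      obtain ⟨σ, hσ, hx, hy⟩ := ty_two (hc _ this.1) (hc _ this.2)
      exact ⟨σ, hσ, ((hs σ hσ).le _ _).2 ⟨hx, hy, h⟩⟩
  cases hT : tyInterp τ
  cases Q
  simp_all

theorem ty_sum (a b : TyExpr) : tyInterp (.sum a b) = sumP (tyInterp a) (tyInterp b) := by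
  refine ty_eq (lawful_sum (lawful_ty a) (lawful_ty b)) ?_ ?_
  · intro σ hσ
    rw [unf_sum] at hσ
    rcases hσ with rfl | ⟨s, hs, t, ht, rfl⟩
    · exact sub_void _
    · exact sub_sum (sub_ty hs) (sub_ty ht)
  · have key : ∀ s ∈ unfolding a, ∀ t ∈ unfolding b, TyExpr.sum s t ∈ unfolding (.sum a b) := by
      intro s hs t ht
      rw [unf_sum]
      exact Or.inr ⟨s, hs, t, ht, rfl⟩
    rintro x ((rfl | ⟨p, ⟨s, hs, hp⟩, rfl⟩) | (rfl | ⟨p, ⟨s, hs, hp⟩, rfl⟩))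
    · exact ⟨_, key _ (void_unf _) _ (void_unf _), Or.inl (Or.inl rfl)⟩
    · exact ⟨_, key _ hs _ (void_unf _), Or.inl (Or.inr ⟨_, hp, rfl⟩)⟩
    · exact ⟨_, key _ (void_unf _) _ (void_unf _), Or.inr (Or.inl rfl)⟩
    · exact ⟨_, key _ (void_unf _) _ hs, Or.inr (Or.inr ⟨_, hp, rfl⟩)⟩

theorem ty_prod (a b : TyExpr) : tyInterp (.prod a b) = prodP (tyInterp a) (tyInterp b) := by
  refine ty_eq (lawful_prod (lawful_ty a) (lawful_ty b)) ?_ ?_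
  · intro σ hσ
    rw [unf_prod] at hσ
    rcases hσ with rfl | ⟨s, hs, t, ht, rfl⟩
    · exact sub_void _
    · exact sub_prod (sub_ty hs) (sub_ty ht)
  · have key : ∀ s ∈ unfolding a, ∀ t ∈ unfolding b, TyExpr.prod s t ∈ unfolding (.prod a b) := by
      intro s hs t ht
      rw [unf_prod]
      exact Or.inr ⟨s, hs, t, ht, rfl⟩
    rintro x (⟨p, ⟨s, hs, hp⟩, rfl⟩ | ⟨p, ⟨s, hs, hp⟩, rfl⟩)
    · exact ⟨_, key _ hs _ (void_unf _), Or.inl ⟨_, hp, rfl⟩⟩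
    · exact ⟨_, key _ (void_unf _) _ hs, Or.inr ⟨_, hp, rfl⟩⟩

theorem ty_arrow (a b : TyExpr) : tyInterp (.arrow a b) = funcP (tyInterp a) (tyInterp b) := by
  refine ty_eq (lawful_func (lawful_ty a) (lawful_ty b)) ?_ ?_
  · intro σ hσ
    rw [unf_arrow] at hσ
    rcases hσ with rfl | ⟨s, hs, t, ht, rfl⟩
    · exact sub_void _
    · exact sub_func (sub_ty hs) (sub_ty ht)
  · rintro x ⟨X, p, rfl, hX, ⟨t, ht, hp⟩⟩
    obtain ⟨s, hs, hsX⟩ := ty_list X hX.1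
    refine ⟨.arrow s t, ?_, X, p, rfl, (sub_good (sub_ty hs) X).2 ⟨hsX, hX⟩, hp⟩
    rw [unf_arrow]
    exact Or.inr ⟨s, hs, t, ht, rfl⟩

/-! ### Domain theory -/

theorem goodify {A : PData} (hA : Lawful A) {d : Set Pm} (hd : A.IsElem d) (L : List Pm)
    (hL : ∀ x ∈ L, x ∈ d) :
    ∃ X, goodList A X ∧ (∀ x ∈ X, x ∈ d) ∧ ∀ l ∈ L, ∃ x ∈ X, A.le l x := by
  classical
  induction L with
  | nil => exact ⟨[], by simp [goodList], by simp, by simp⟩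
  | cons a L ih =>
    obtain ⟨X, hX, hXd, hc⟩ := ih fun x hx => hL x (by simp [hx])
    have had : a ∈ d := hL a (by simp)
    by_cases h : ∃ x ∈ X, A.le a x
    · refine ⟨X, hX, hXd, fun l hl => ?_⟩
      rcases List.mem_cons.1 hl with rfl | hl
      · exact h
      · exact hc l hl
    · push Not at h
      have hmem : ∀ x ∈ a :: X.filter (fun x => ¬ A.le x a), x ∈ d := by
        intro x hx
        rcases List.mem_cons.1 hx with rfl | hx
        · exact had
        · exact hXd x (List.mem_filter.1 hx).1
      refine ⟨a :: X.filter (fun x => ¬ A.le x a), ⟨fun x hx => hd.1 (hmem x hx), ?_⟩, hmem, ?_⟩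
      · intro x hx y hy
        refine ⟨hd.2.2 x (hmem x hx) y (hmem y hy), fun hle => ?_⟩
        rcases List.mem_cons.1 hx with rfl | hx <;> rcases List.mem_cons.1 hy with rfl | hy
        · rfl
        · exact absurd hle (h y (List.mem_filter.1 hy).1)
        · have := (List.mem_filter.1 hx).2
          simp at this
          exact absurd hle this
        · exact (hX.2 x (List.mem_filter.1 hx).1 y (List.mem_filter.1 hy).1).2 hle
      · intro l hl
        rcases List.mem_cons.1 hl with rfl | hl
        · exact ⟨l, by simp, hA.le_refl _ (hd.1 had)⟩
        · obtain ⟨x, hx, hlx⟩ := hc l hl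
          by_cases hxa : A.le x a
          · exact ⟨a, by simp, hA.le_trans _ _ _ hlx hxa⟩
          · exact ⟨x, by simp [hx, hxa], hlx⟩

theorem down_elem {A : PData} (hA : Lawful A) {X : List Pm}
    (hX : ∀ x ∈ X, ∀ y ∈ X, A.con x y) : A.IsElem (downListP A X) := by
  refine ⟨?_, ?_, ?_⟩
  · rintro a ⟨x, hx, h⟩
    exact (hA.le_car _ _ h).1
  · rintro a b hab ⟨x, hx, h⟩
    exact ⟨x, hx, hA.le_trans _ _ _ hab h⟩
  · rintro a ⟨x, hx, h⟩ b ⟨y, hy, h'⟩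
    exact hA.con_down _ _ _ h (hA.con_symm _ _ (hA.con_down _ _ _ h' (hA.con_symm _ _ (hX x hx y hy))))

theorem good_elem {A : PData} (hA : Lawful A) {X : List Pm} (hX : goodList A X) :
    A.IsElem (downListP A X) :=
  down_elem hA fun x hx y hy => (hX.2 x hx y hy).1

/-- Monotone functions determined by finite subsets. -/
def Cts (f : Set Pm → Set Pm) : Prop :=
  Monotone f ∧ ∀ d b, b ∈ f d → ∃ L : List Pm, (∀ x ∈ L, x ∈ d) ∧ b ∈ f {x | x ∈ L}

theorem aps_PrOf {A : PData} (hA : Lawful A) {f : Set Pm → Set Pm} (hf : Cts f)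
    {d : Set Pm} (hd : A.IsElem d) : aps (PrOf A f) d = f d := by
  ext b
  constructor
  · rintro ⟨X, hX, X', b', e, hg, hb⟩
    cases e
    refine hf.1 ?_ hb
    rintro a ⟨x, hx, h⟩
    exact hd.2.1 _ _ h (hX x hx)
  · intro hb
    obtain ⟨L, hL, hb⟩ := hf.2 _ _ hb
    obtain ⟨X, hX, hXd, hc⟩ := goodify hA hd L hL
    exact ⟨X, hXd, X, b, rfl, hX, hf.1 (fun l hl => hc l hl) hb⟩

theorem PrOf_elem {A B : PData} (hA : Lawful A) {f : Set Pm → Set Pm}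
    (hm : Monotone f) (hf : ∀ d, A.IsElem d → B.IsElem (f d)) :
    (funcP A B).IsElem (PrOf A f) := by
  refine ⟨?_, ?_, ?_⟩
  · rintro x ⟨X, a, rfl, hX, ha⟩
    exact ⟨X, a, rfl, hX, (hf _ (good_elem hA hX)).1 ha⟩
  · rintro x y ⟨X, a, Y, b, rfl, rfl, hX, ha, hY, hb, h, h1⟩ ⟨Y', b', e, -, hb'⟩
    cases e
    refine ⟨X, a, rfl, hX, (hf _ (good_elem hA hX)).2.1 _ _ h1 (hm ?_ hb')⟩
    rintro p ⟨v, hv, hpv⟩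
    obtain ⟨u, hu, hvu⟩ := h v hv
    exact ⟨u, hu, hA.le_trans _ _ _ hpv hvu⟩
  · rintro x ⟨X, a, rfl, hX, ha⟩ y ⟨Y, b, rfl, hY, hb⟩
    refine ⟨X, a, Y, b, rfl, rfl, hX, (hf _ (good_elem hA hX)).1 ha, hY,
      (hf _ (good_elem hA hY)).1 hb, fun hc => ?_⟩
    have hE : A.IsElem (downListP A (X ++ Y)) := by
      refine down_elem hA ?_
      intro x hx y hy
      rcases List.mem_append.1 hx with hx | hx <;> rcases List.mem_append.1 hy with hy | hy
      · exact (hX.2 x hx y hy).1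
      · exact hc x hx y hy
      · exact hA.con_symm _ _ (hc y hy x hx)
      · exact (hY.2 x hx y hy).1
    refine (hf _ hE).2.2 _ (hm ?_ ha) _ (hm ?_ hb)
    · rintro p ⟨v, hv, hpv⟩
      exact ⟨v, by simp [hv], hpv⟩
    · rintro p ⟨v, hv, hpv⟩
      exact ⟨v, by simp [hv], hpv⟩

theorem aps_elem {A B : PData} (hA : Lawful A) (hB : Lawful B) {r d : Set Pm}
    (hr : (funcP A B).IsElem r) (hd : A.IsElem d) : B.IsElem (aps r d) := by
  refine ⟨?_, ?_, ?_⟩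
  · rintro b ⟨X, hX, h⟩
    obtain ⟨_, _, e, -, hb⟩ := hr.1 h
    cases e
    exact hb
  · rintro a b hab ⟨X, hX, h⟩
    refine ⟨X, hX, hr.2.1 _ _ ?_ h⟩
    obtain ⟨_, _, e, hg, hb⟩ := hr.1 h
    cases e
    exact ⟨X, a, X, b, rfl, rfl, hg, (hB.le_car _ _ hab).1, hg, hb,
      fun v hv => ⟨v, hv, hA.le_refl _ (hg.1 v hv)⟩, hab⟩
  · rintro a ⟨X, hX, ha⟩ b ⟨Y, hY, hb⟩
    obtain ⟨_, _, _, _, e1, e2, -, -, -, -, h⟩ := hr.2.2 _ ha _ hb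
    cases e1; cases e2
    exact h fun u hu v hv => hd.2.2 _ (hX u hu) _ (hY v hv)

theorem aps_mono {r r' d d' : Set Pm} (h : r ⊆ r') (h' : d ⊆ d') : aps r d ⊆ aps r' d' := by
  rintro b ⟨X, hX, hb⟩
  exact ⟨X, fun x hx => h' (hX x hx), h hb⟩

theorem PrOf_mono {A : PData} {f g : Set Pm → Set Pm} (h : ∀ d, f d ⊆ g d) :
    PrOf A f ⊆ PrOf A g := by
  rintro b ⟨X, a, rfl, hX, ha⟩
  exact ⟨X, a, rfl, hX, h _ ha⟩

theorem PrOf_congr {A : PData} (hA : Lawful A) {f g : Set Pm → Set Pm}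
    (h : ∀ d, A.IsElem d → f d = g d) : PrOf A f = PrOf A g := by
  ext x
  constructor
  · rintro ⟨X, a, rfl, hX, ha⟩
    exact ⟨X, a, rfl, hX, h _ (good_elem hA hX) ▸ ha⟩
  · rintro ⟨X, a, rfl, hX, ha⟩
    exact ⟨X, a, rfl, hX, (h _ (good_elem hA hX)).symm ▸ ha⟩

theorem empty_elem (A : PData) : A.IsElem ∅ := by
  refine ⟨?_, ?_, ?_⟩ <;> simp

/-! ### Semantics of terms -/

theorem sem_mono (M : Tm) : ∀ ε ε' : Env, (∀ n, ε n ⊆ ε' n) → sem M ε ⊆ sem M ε' := by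
  induction M with
  | var n => exact fun ε ε' h => h n
  | const c => exact fun ε ε' h => subset_rfl
  | app M N h1 h2 => exact fun ε ε' h => aps_mono (h1 _ _ h) (h2 _ _ h)
  | lam σ M ih =>
    intro ε ε' h
    refine PrOf_mono fun d => ih _ _ fun n => ?_
    cases n with
    | zero => exact subset_rfl
    | succ n => exact h n

theorem sem_list (M : Tm) (ε : Env)
    (h : ∀ b ∈ sem M ε, ∃ L : ℕ → List Pm, (∀ n, ∀ x ∈ L n, x ∈ ε n) ∧
      b ∈ sem M (fun n => {x | x ∈ L n})) (X : List Pm) (hX : ∀ x ∈ X, x ∈ sem M ε) :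
    ∃ L : ℕ → List Pm, (∀ n, ∀ x ∈ L n, x ∈ ε n) ∧
      ∀ x ∈ X, x ∈ sem M (fun n => {x | x ∈ L n}) := by
  induction X with
  | nil => exact ⟨fun _ => [], by simp, by simp⟩
  | cons a X ih =>
    obtain ⟨L1, h1, h1'⟩ := h a (hX a (by simp))
    obtain ⟨L2, h2, h2'⟩ := ih fun x hx => hX x (by simp [hx])
    refine ⟨fun n => L1 n ++ L2 n, ?_, ?_⟩
    · intro n x hx
      rcases List.mem_append.1 hx with hx | hx
      · exact h1 n x hx
      · exact h2 n x hx
    · intro x hx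
      rcases List.mem_cons.1 hx with rfl | hx
      · exact sem_mono M _ _ (fun n y hy => List.mem_append.2 (Or.inl hy)) h1'
      · exact sem_mono M _ _ (fun n y hy => List.mem_append.2 (Or.inr hy)) (h2' x hx)

theorem sem_fin (M : Tm) : ∀ (ε : Env) (b : Pm), b ∈ sem M ε →
    ∃ L : ℕ → List Pm, (∀ n, ∀ x ∈ L n, x ∈ ε n) ∧ b ∈ sem M (fun n => {x | x ∈ L n}) := by
  classical
  induction M with
  | var n =>
    intro ε b hb
    refine ⟨fun m => if m = n then [b] else [], ?_, ?_⟩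
    · intro m x hx
      by_cases h : m = n
      · subst h
        simp at hx
        subst hx
        exact hb
      · simp [h] at hx
    · simp [sem]
  | const c => exact fun ε b hb => ⟨fun _ => [], by simp, hb⟩
  | app M N h1 h2 =>
    rintro ε b ⟨X, hX, hb⟩
    obtain ⟨L1, l1, l1'⟩ := h1 _ _ hb
    obtain ⟨L2, l2, l2'⟩ := sem_list N ε (h2 ε) X hX
    refine ⟨fun n => L1 n ++ L2 n, ?_, X, ?_, ?_⟩
    · intro n x hx
      rcases List.mem_append.1 hx with hx | hx
      · exact l1 n x hx
      · exact l2 n x hx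
    · exact fun x hx => sem_mono N _ _ (fun n y hy => List.mem_append.2 (Or.inr hy)) (l2' x hx)
    · exact sem_mono M _ _ (fun n y hy => List.mem_append.2 (Or.inl hy)) l1'
  | lam σ M ih =>
    rintro ε b ⟨X, a, rfl, hX, ha⟩
    obtain ⟨L, l, l'⟩ := ih _ _ ha
    refine ⟨fun n => L (n + 1), fun n x hx => l (n + 1) x hx, X, a, rfl, hX, ?_⟩
    refine sem_mono M _ _ (fun n => ?_) l'
    cases n with
    | zero => exact fun x hx => l 0 x hx
    | succ n => exact subset_rfl

theorem sem_cts (M : Tm) (ε : Env) : Cts fun d => sem M (envCons d ε) := by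
  constructor
  · intro d d' h
    refine sem_mono M _ _ fun n => ?_
    cases n with
    | zero => exact h
    | succ n => exact subset_rfl
  · intro d b hb
    obtain ⟨L, l, l'⟩ := sem_fin M _ _ hb
    refine ⟨L 0, l 0, sem_mono M _ _ (fun n => ?_) l'⟩
    cases n with
    | zero => exact subset_rfl
    | succ n => exact fun x hx => l (n + 1) x hx

theorem sem_lift (M : Tm) : ∀ (d : ℕ) (ε ε' : Env), (∀ n, n < d → ε n = ε' n) →
    (∀ n, d ≤ n → ε (n + 1) = ε' n) → sem (liftTm d M) ε = sem M ε' := by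
  induction M with
  | var n =>
    intro d ε ε' h h'
    by_cases hn : n < d
    · simp [liftTm, hn, sem, h]
    · simp [liftTm, hn, sem, h' n (by omega)]
  | const c => exact fun _ _ _ _ _ => rfl
  | app M N h1 h2 =>
    intro d ε ε' h h'
    simp only [liftTm, sem]
    rw [h1 d ε ε' h h', h2 d ε ε' h h']
  | lam σ M ih =>
    intro d ε ε' h h'
    simp only [liftTm, sem]
    congr 1
    funext e
    refine ih _ _ _ ?_ ?_
    · rintro (_ | n) hn
      · rfl
      · exact h n (by omega)
    · rintro (_ | n) hn
      · omega
      · exact h' n (by omega)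

theorem sem_subst (M : Tm) : ∀ (k : ℕ) (N : Tm) (ε ε' : Env), (∀ n, n < k → ε n = ε' n) →
    ε' k = sem N ε → (∀ n, k ≤ n → ε n = ε' (n + 1)) →
    sem (substTm M k N) ε = sem M ε' := by
  induction M with
  | var n =>
    intro k N ε ε' h1 h2 h3
    rcases lt_trichotomy n k with hn | rfl | hn
    · have : ¬ k < n := by omega
      simp [substTm, hn.ne, this, sem, h1 n hn]
    · simp [substTm, sem, h2]
    · obtain ⟨m, rfl⟩ : ∃ m, n = m + 1 := ⟨n - 1, by omega⟩
      simp [substTm, hn.ne', hn, sem, h3 m (by omega)]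
  | const c => intros; rfl
  | app M P i1 i2 =>
    intro k N ε ε' h1 h2 h3
    simp only [substTm, sem]
    rw [i1 k N ε ε' h1 h2 h3, i2 k N ε ε' h1 h2 h3]
  | lam σ M ih =>
    intro k N ε ε' h1 h2 h3
    simp only [substTm, sem]
    congr 1
    funext e
    refine ih _ _ _ _ ?_ ?_ ?_
    · rintro (_ | n) hn
      · rfl
      · exact h1 n (by omega)
    · rw [sem_lift N 0 (envCons e ε) ε (by simp) (fun n _ => rfl)]
      exact h2
    · rintro (_ | n) hn
      · omega
      · exact h3 n (by omega)

theorem sem_subst0 (M N : Tm) (ε : Env) :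
    sem (substTm M 0 N) ε = sem M (envCons (sem N ε) ε) :=
  sem_subst M 0 N ε _ (by simp) rfl (fun _ _ => rfl)

/-! ### Typing -/

theorem ht_lift {Γ : List TyExpr} {M : Tm} {τ : TyExpr} (h : HasType Γ M τ) :
    ∀ (d : ℕ) (Δ : List TyExpr), (∀ n, n < d → Δ[n]? = Γ[n]?) →
      (∀ n, d ≤ n → Δ[n + 1]? = Γ[n]?) → HasType Δ (liftTm d M) τ := by
  induction h with
  | @var Γ n σ h =>
    intro d Δ h1 h2
    by_cases hn : n < d
    · simp only [liftTm, hn, if_true]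
      exact .var (by rw [h1 n hn, h])
    · simp only [liftTm, hn, if_false]
      exact .var (by rw [h2 n (by omega), h])
  | const c => intros; exact .const c
  | app _ _ i1 i2 => exact fun d Δ h1 h2 => .app (i1 d Δ h1 h2) (i2 d Δ h1 h2)
  | lam _ ih =>
    intro d Δ h1 h2
    refine .lam (ih _ _ ?_ ?_)
    · rintro (_ | n) hn
      · rfl
      · simpa using h1 n (by omega)
    · rintro (_ | n) hn
      · omega
      · simpa using h2 n (by omega)
  | equiv _ e ih => exact fun d Δ h1 h2 => .equiv (ih d Δ h1 h2) e

theorem ht_subst {Γ : List TyExpr} {M : Tm} {τ : TyExpr} (h : HasType Γ M τ) :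
    ∀ (k : ℕ) (N : Tm) (Δ : List TyExpr), (∀ n, n < k → Δ[n]? = Γ[n]?) →
      (∀ s, Γ[k]? = some s → HasType Δ N s) →
      (∀ n, k ≤ n → Δ[n]? = Γ[n + 1]?) → HasType Δ (substTm M k N) τ := by
  induction h with
  | @var Γ n σ h =>
    intro k N Δ h1 h2 h3
    rcases lt_trichotomy n k with hn | rfl | hn
    · have : ¬ k < n := by omega
      simp only [substTm, hn.ne, this, if_false]
      exact .var (by rw [h1 n hn, h])
    · simp only [substTm, if_true]
      exact h2 _ h
    · obtain ⟨m, rfl⟩ : ∃ m, n = m + 1 := ⟨n - 1, by omega⟩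
      simp only [substTm, hn.ne', hn, if_true, if_false]
      exact .var (by rw [Nat.add_sub_cancel, h3 m (by omega), h])
  | const c => intros; exact .const c
  | app _ _ i1 i2 => exact fun k N Δ h1 h2 h3 => .app (i1 k N Δ h1 h2 h3) (i2 k N Δ h1 h2 h3)
  | lam _ ih =>
    intro k N Δ h1 h2 h3
    refine .lam (ih _ _ _ ?_ ?_ ?_)
    · rintro (_ | n) hn
      · rfl
      · simpa using h1 n (by omega)
    · intro s hs
      exact ht_lift (h2 s (by simpa using hs)) 0 _ (by simp) (by simp)
    · rintro (_ | n) hn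
      · omega
      · simpa using h3 n (by omega)
  | equiv _ e ih => exact fun k N Δ h1 h2 h3 => .equiv (ih k N Δ h1 h2 h3) e

theorem ht_subst0 {Γ : List TyExpr} {M N : Tm} {σ τ : TyExpr} (h : HasType (σ :: Γ) M τ)
    (hN : HasType Γ N σ) : HasType Γ (substTm M 0 N) τ := by
  refine ht_subst h 0 N Γ (by simp) ?_ (by simp)
  intro s hs
  simp at hs
  exact hs ▸ hN

theorem inv_app {Γ : List TyExpr} {M N : Tm} {τ : TyExpr} (h : HasType Γ (.app M N) τ) :
    ∃ σ, HasType Γ M (.arrow σ τ) ∧ HasType Γ N σ := by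
  generalize hT : Tm.app M N = T at h
  induction h with
  | app h1 h2 => cases hT; exact ⟨_, h1, h2⟩
  | equiv _ e ih =>
    obtain ⟨σ, h1, h2⟩ := ih hT
    exact ⟨σ, h1.equiv (.arrow (.refl _) e), h2⟩
  | _ => cases hT

theorem inv_lam {Γ : List TyExpr} {M : Tm} {σ τ : TyExpr} (h : HasType Γ (.lam σ M) τ) :
    ∃ ρ, HasType (σ :: Γ) M ρ ∧ TyEquiv (.arrow σ ρ) τ := by
  generalize hT : Tm.lam σ M = T at h
  induction h with
  | lam h1 => cases hT; exact ⟨_, h1, .refl _⟩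
  | equiv _ e ih =>
    obtain ⟨ρ, h1, h2⟩ := ih hT
    exact ⟨ρ, h1, h2.trans e⟩
  | _ => cases hT

theorem inv_const {Γ : List TyExpr} {c : Const} {τ : TyExpr} (h : HasType Γ (.const c) τ) :
    TyEquiv (constType c) τ := by
  generalize hT : Tm.const c = T at h
  induction h with
  | const c => cases hT; exact .refl _
  | equiv _ e ih => exact (ih hT).trans e
  | _ => cases hT

theorem inv_c1 {Γ : List TyExpr} {c : Const} {x : Tm} {τ a r : TyExpr}
    (hc : constType c = .arrow a r)
    (h : HasType Γ (.app (.const c) x) τ) : HasType Γ x a ∧ TyEquiv r τ := by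
  obtain ⟨σ, h1, h2⟩ := inv_app h
  have e := inv_const h1
  rw [hc] at e
  exact ⟨h2.equiv e.arrow_inv.1.symm, e.arrow_inv.2⟩

theorem inv_c2 {Γ : List TyExpr} {c : Const} {x y : Tm} {τ a b r : TyExpr}
    (hc : constType c = .arrow a (.arrow b r))
    (h : HasType Γ (.app (.app (.const c) x) y) τ) :
    HasType Γ x a ∧ HasType Γ y b ∧ TyEquiv r τ := by
  obtain ⟨σ, h1, h2⟩ := inv_app h
  obtain ⟨hx, e⟩ := inv_c1 hc h1
  exact ⟨hx, h2.equiv e.arrow_inv.1.symm, e.arrow_inv.2⟩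

theorem inv_c3 {Γ : List TyExpr} {c : Const} {x y z : Tm} {τ a b d r : TyExpr}
    (hc : constType c = .arrow a (.arrow b (.arrow d r)))
    (h : HasType Γ (.app (.app (.app (.const c) x) y) z) τ) :
    HasType Γ x a ∧ HasType Γ y b ∧ HasType Γ z d ∧ TyEquiv r τ := by
  obtain ⟨σ, h1, h2⟩ := inv_app h
  obtain ⟨hx, hy, e⟩ := inv_c2 hc h1
  exact ⟨hx, hy, h2.equiv e.arrow_inv.1.symm, e.arrow_inv.2⟩

/-! ### Constants -/

theorem cts_inj0 : Cts inj0 := by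
  refine ⟨?_, ?_⟩
  · rintro d d' h p (rfl | ⟨a, ha, rfl⟩)
    · exact Or.inl rfl
    · exact Or.inr ⟨a, h ha, rfl⟩
  · rintro d b (rfl | ⟨a, ha, rfl⟩)
    · exact ⟨[], by simp, Or.inl rfl⟩
    · exact ⟨[a], by simpa using ha, Or.inr ⟨a, by simp, rfl⟩⟩

theorem cts_inj1 : Cts inj1 := by
  refine ⟨?_, ?_⟩
  · rintro d d' h p (rfl | ⟨a, ha, rfl⟩)
    · exact Or.inl rfl
    · exact Or.inr ⟨a, h ha, rfl⟩
  · rintro d b (rfl | ⟨a, ha, rfl⟩)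
    · exact ⟨[], by simp, Or.inl rfl⟩
    · exact ⟨[a], by simpa using ha, Or.inr ⟨a, by simp, rfl⟩⟩

theorem cts_fst : Cts fstS :=
  ⟨fun _ _ h _ ha => h ha, fun _ b hb => ⟨[.ppr false b], by simpa [fstS] using hb, by simp [fstS]⟩⟩

theorem cts_snd : Cts sndS :=
  ⟨fun _ _ h _ ha => h ha, fun _ b hb => ⟨[.ppr true b], by simpa [sndS] using hb, by simp [sndS]⟩⟩

theorem cts_PrOf {A : PData} {F : Set Pm → Set Pm → Set Pm} (h : ∀ e, Cts fun d => F d e) :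
    Cts fun d => PrOf A (F d) := by
  constructor
  · intro d d' hd
    exact PrOf_mono fun e => (h e).1 hd
  · rintro d b ⟨X, a, rfl, hX, ha⟩
    obtain ⟨L, hL, hb⟩ := (h _).2 _ _ ha
    exact ⟨L, hL, X, a, rfl, hX, hb⟩

theorem pairS_mono {d d' e e' : Set Pm} (h : d ⊆ d') (h' : e ⊆ e') : pairS d e ⊆ pairS d' e' := by
  rintro p (⟨a, ha, rfl⟩ | ⟨a, ha, rfl⟩)
  · exact Or.inl ⟨a, h ha, rfl⟩
  · exact Or.inr ⟨a, h' ha, rfl⟩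

theorem cts_pair1 (e : Set Pm) : Cts fun d => pairS d e := by
  refine ⟨fun d d' h => pairS_mono h subset_rfl, ?_⟩
  rintro d b (⟨a, ha, rfl⟩ | ⟨a, ha, rfl⟩)
  · exact ⟨[a], by simpa using ha, Or.inl ⟨a, by simp, rfl⟩⟩
  · exact ⟨[], by simp, Or.inr ⟨a, ha, rfl⟩⟩

theorem cts_pair2 (d : Set Pm) : Cts fun e => pairS d e := by
  refine ⟨fun e e' h => pairS_mono subset_rfl h, ?_⟩
  rintro e b (⟨a, ha, rfl⟩ | ⟨a, ha, rfl⟩)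
  · exact ⟨[], by simp, Or.inl ⟨a, ha, rfl⟩⟩
  · exact ⟨[a], by simpa using ha, Or.inr ⟨a, by simp, rfl⟩⟩

theorem caseS_mono {d d' f f' g g' : Set Pm} (h : d ⊆ d') (hf : f ⊆ f') (hg : g ⊆ g') :
    caseS d f g ⊆ caseS d' f' g' := by
  rintro p (⟨h1, h2⟩ | ⟨h1, h2⟩)
  · exact Or.inl ⟨h h1, aps_mono hf (show prj0 d ⊆ prj0 d' from fun a ha => h ha) h2⟩
  · exact Or.inr ⟨h h1, aps_mono hg (show prj1 d ⊆ prj1 d' from fun a ha => h ha) h2⟩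

theorem cts_case1 (f g : Set Pm) : Cts fun d => caseS d f g := by
  refine ⟨fun d d' h => caseS_mono h subset_rfl subset_rfl, ?_⟩
  rintro d b (⟨h1, X, hX, hb⟩ | ⟨h1, X, hX, hb⟩)
  · refine ⟨.stag false :: X.map (.spr false), ?_, Or.inl ⟨by simp, X, ?_, hb⟩⟩
    · simp [h1]
      exact hX
    · intro x hx
      simp [prj0, hx]
  · refine ⟨.stag true :: X.map (.spr true), ?_, Or.inr ⟨by simp, X, ?_, hb⟩⟩
    · simp [h1]
      exact hX
    · intro x hx
      simp [prj1, hx]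

theorem cts_case2 (d g : Set Pm) : Cts fun f => caseS d f g := by
  refine ⟨fun f f' h => caseS_mono subset_rfl h subset_rfl, ?_⟩
  rintro f b (⟨h1, X, hX, hb⟩ | h)
  · exact ⟨[.fn X b], by simpa using hb, Or.inl ⟨h1, X, hX, by simp⟩⟩
  · exact ⟨[], by simp, Or.inr h⟩

theorem cts_case3 (d f : Set Pm) : Cts fun g => caseS d f g := by
  refine ⟨fun g g' h => caseS_mono subset_rfl subset_rfl h, ?_⟩
  rintro g b (h | ⟨h1, X, hX, hb⟩)
  · exact ⟨[], by simp, Or.inl h⟩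
  · exact ⟨[.fn X b], by simpa using hb, Or.inr ⟨h1, X, hX, by simp⟩⟩

theorem pcaseS_mono {a a' b b' c c' : Set Pm} (ha : a ⊆ a') (hb : b ⊆ b') (hc : c ⊆ c') :
    pcaseS a b c ⊆ pcaseS a' b' c' := by
  rintro p (⟨h1, h2, h3⟩ | ⟨h1, h2⟩ | ⟨h1, h2⟩)
  · have h4 := hb h3.1
    have h5 := hc h3.2
    by_cases k1 : Pm.stag false ∈ a'
    · exact Or.inr (Or.inl ⟨k1, h4⟩)
    · by_cases k2 : Pm.stag true ∈ a'
      · exact Or.inr (Or.inr ⟨k2, h5⟩)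
      · exact Or.inl ⟨k1, k2, h4, h5⟩
  · exact Or.inr (Or.inl ⟨ha h1, hb h2⟩)
  · exact Or.inr (Or.inr ⟨ha h1, hc h2⟩)

theorem cts_pcase1 (b c : Set Pm) : Cts fun a => pcaseS a b c := by
  refine ⟨fun d d' h => pcaseS_mono h subset_rfl subset_rfl, ?_⟩
  rintro d p (⟨h1, h2, h3⟩ | ⟨h1, h2⟩ | ⟨h1, h2⟩)
  · exact ⟨[], by simp, Or.inl ⟨by simp, by simp, h3⟩⟩
  · exact ⟨[.stag false], by simpa using h1, Or.inr (Or.inl ⟨by simp, h2⟩)⟩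
  · exact ⟨[.stag true], by simpa using h1, Or.inr (Or.inr ⟨by simp, h2⟩)⟩

theorem cts_pcase2 (a c : Set Pm) : Cts fun b => pcaseS a b c := by
  refine ⟨fun d d' h => pcaseS_mono subset_rfl h subset_rfl, ?_⟩
  rintro d p (⟨h1, h2, h3⟩ | ⟨h1, h2⟩ | ⟨h1, h2⟩)
  · exact ⟨[p], by simpa using h3.1, Or.inl ⟨h1, h2, by simp, h3.2⟩⟩
  · exact ⟨[p], by simpa using h2, Or.inr (Or.inl ⟨h1, by simp⟩)⟩
  · exact ⟨[], by simp, Or.inr (Or.inr ⟨h1, h2⟩)⟩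

theorem cts_pcase3 (a b : Set Pm) : Cts fun c => pcaseS a b c := by
  refine ⟨fun d d' h => pcaseS_mono subset_rfl subset_rfl h, ?_⟩
  rintro d p (⟨h1, h2, h3⟩ | ⟨h1, h2⟩ | ⟨h1, h2⟩)
  · exact ⟨[p], by simpa using h3.2, Or.inl ⟨h1, h2, h3.1, by simp⟩⟩
  · exact ⟨[], by simp, Or.inr (Or.inl ⟨h1, h2⟩)⟩
  · exact ⟨[p], by simpa using h2, Or.inr (Or.inr ⟨h1, by simp⟩)⟩

theorem inj0_elem {A B : PData} {d : Set Pm} (hd : A.IsElem d) :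
    (sumP A B).IsElem (inj0 d) := by
  have hs : ∀ p ∈ inj0 d, p ∈ sumSideP A false := by
    rintro p (rfl | ⟨a, ha, rfl⟩)
    · exact Or.inl rfl
    · exact Or.inr ⟨a, hd.1 ha, rfl⟩
  refine ⟨fun p hp => Or.inl (hs p hp), ?_, ?_⟩
  · rintro x y (⟨rfl, h⟩ | ⟨rfl, h⟩ | ⟨a, b, rfl, rfl, h⟩ | ⟨a, b, rfl, rfl, h⟩) hy
    · exact Or.inl rfl
    · exact (sumSide_disj (hs _ hy) h).elim
    · simp [inj0] at hy
      exact Or.inr ⟨a, hd.2.1 _ _ h hy, rfl⟩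
    · simp [inj0] at hy
  · intro x hx y hy
    refine Or.inl ⟨hs _ hx, hs _ hy, ?_⟩
    rintro a b rfl rfl
    simp [inj0] at hx hy
    exact hd.2.2 _ hx _ hy

theorem inj1_elem {A B : PData} {d : Set Pm} (hd : B.IsElem d) :
    (sumP A B).IsElem (inj1 d) := by
  have hs : ∀ p ∈ inj1 d, p ∈ sumSideP B true := by
    rintro p (rfl | ⟨a, ha, rfl⟩)
    · exact Or.inl rfl
    · exact Or.inr ⟨a, hd.1 ha, rfl⟩
  refine ⟨fun p hp => Or.inr (hs p hp), ?_, ?_⟩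
  · rintro x y (⟨rfl, h⟩ | ⟨rfl, h⟩ | ⟨a, b, rfl, rfl, h⟩ | ⟨a, b, rfl, rfl, h⟩) hy
    · exact (sumSide_disj h (hs _ hy)).elim
    · exact Or.inl rfl
    · simp [inj1] at hy
    · simp [inj1] at hy
      exact Or.inr ⟨a, hd.2.1 _ _ h hy, rfl⟩
  · intro x hx y hy
    refine Or.inr ⟨hs _ hx, hs _ hy, ?_⟩
    rintro a b rfl rfl
    simp [inj1] at hx hy
    exact hd.2.2 _ hx _ hy

theorem pair_elem {A B : PData} {d e : Set Pm} (hd : A.IsElem d) (he : B.IsElem e) :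
    (prodP A B).IsElem (pairS d e) := by
  refine ⟨?_, ?_, ?_⟩
  · rintro p (⟨a, ha, rfl⟩ | ⟨a, ha, rfl⟩)
    · exact Or.inl ⟨a, hd.1 ha, rfl⟩
    · exact Or.inr ⟨a, he.1 ha, rfl⟩
  · rintro x y (⟨a, b, rfl, rfl, h⟩ | ⟨a, b, rfl, rfl, h⟩) hy
    · simp [pairS] at hy
      exact Or.inl ⟨a, hd.2.1 _ _ h hy, rfl⟩
    · simp [pairS] at hy
      exact Or.inr ⟨a, he.2.1 _ _ h hy, rfl⟩
  · rintro x (⟨a, ha, rfl⟩ | ⟨a, ha, rfl⟩) y (⟨b, hb, rfl⟩ | ⟨b, hb, rfl⟩)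
    · simpa [prodP] using hd.2.2 _ ha _ hb
    · simpa [prodP] using ⟨hd.1 ha, he.1 hb⟩
    · simpa [prodP] using ⟨he.1 ha, hd.1 hb⟩
    · simpa [prodP] using he.2.2 _ ha _ hb

theorem fst_elem {A B : PData} {d : Set Pm} (hd : (prodP A B).IsElem d) :
    A.IsElem (fstS d) := by
  refine ⟨?_, ?_, ?_⟩
  · intro a ha
    simpa [prodP] using hd.1 ha
  · intro a b hab hb
    exact hd.2.1 _ _ (Or.inl ⟨a, b, rfl, rfl, hab⟩) hb
  · intro a ha b hb
    simpa [prodP] using hd.2.2 _ ha _ hb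

theorem snd_elem {A B : PData} {d : Set Pm} (hd : (prodP A B).IsElem d) :
    B.IsElem (sndS d) := by
  refine ⟨?_, ?_, ?_⟩
  · intro a ha
    simpa [prodP] using hd.1 ha
  · intro a b hab hb
    exact hd.2.1 _ _ (Or.inr ⟨a, b, rfl, rfl, hab⟩) hb
  · intro a ha b hb
    simpa [prodP] using hd.2.2 _ ha _ hb

theorem prj0_elem {A B : PData} {d : Set Pm} (hd : (sumP A B).IsElem d) :
    A.IsElem (prj0 d) := by
  refine ⟨?_, ?_, ?_⟩
  · intro a ha
    simpa [sumP, sumSideP] using hd.1 ha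
  · intro a b hab hb
    exact hd.2.1 _ _ (Or.inr (Or.inr (Or.inl ⟨a, b, rfl, rfl, hab⟩))) hb
  · intro a ha b hb
    have := hd.2.2 _ ha _ hb
    simp [sumP, sumSideP] at this
    exact this.2.2

theorem prj1_elem {A B : PData} {d : Set Pm} (hd : (sumP A B).IsElem d) :
    B.IsElem (prj1 d) := by
  refine ⟨?_, ?_, ?_⟩
  · intro a ha
    simpa [sumP, sumSideP] using hd.1 ha
  · intro a b hab hb
    exact hd.2.1 _ _ (Or.inr (Or.inr (Or.inr ⟨a, b, rfl, rfl, hab⟩))) hb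
  · intro a ha b hb
    have := hd.2.2 _ ha _ hb
    simp [sumP, sumSideP] at this
    exact this.2.2

theorem tags {A B : PData} {d : Set Pm} (hd : (sumP A B).IsElem d)
    (h : Pm.stag false ∈ d) (h' : Pm.stag true ∈ d) : False := by
  have := hd.2.2 _ h _ h'
  simp [sumP, sumSideP] at this

theorem inter_elem {A : PData} {d e : Set Pm} (hd : A.IsElem d) (he : A.IsElem e) :
    A.IsElem (d ∩ e) :=
  ⟨fun _ ha => hd.1 ha.1, fun _ _ h hb => ⟨hd.2.1 _ _ h hb.1, he.2.1 _ _ h hb.2⟩,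
    fun _ ha _ hb => hd.2.2 _ ha.1 _ hb.1⟩

theorem pcase_elem {A B C : PData} {a b c : Set Pm} (ha : (sumP A B).IsElem a)
    (hb : C.IsElem b) (hc : C.IsElem c) : C.IsElem (pcaseS a b c) := by
  by_cases h0 : Pm.stag false ∈ a
  · have h1 : Pm.stag true ∉ a := fun h => tags ha h0 h
    have : pcaseS a b c = b := by ext p; simp [pcaseS, h0, h1]
    rwa [this]
  · by_cases h1 : Pm.stag true ∈ a
    · have : pcaseS a b c = c := by ext p; simp [pcaseS, h0, h1]
      rwa [this]
    · have : pcaseS a b c = b ∩ c := by ext p; simp [pcaseS, h0, h1]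
      rw [this]
      exact inter_elem hb hc

theorem case_elem {A B C : PData} (hA : Lawful A) (hB : Lawful B) (hC : Lawful C)
    {d f g : Set Pm} (hd : (sumP A B).IsElem d)
    (hf : (funcP A C).IsElem f) (hg : (funcP B C).IsElem g) : C.IsElem (caseS d f g) := by
  by_cases h0 : Pm.stag false ∈ d
  · have h1 : Pm.stag true ∉ d := fun h => tags hd h0 h
    have : caseS d f g = aps f (prj0 d) := by ext p; simp [caseS, h0, h1]
    rw [this]
    exact aps_elem hA hC hf (prj0_elem hd)
  · by_cases h1 : Pm.stag true ∈ d
    · have : caseS d f g = aps g (prj1 d) := by ext p; simp [caseS, h0, h1]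
      rw [this]
      exact aps_elem hB hC hg (prj1_elem hd)
    · have : caseS d f g = ∅ := by ext p; simp [caseS, h0, h1]
      rw [this]
      exact empty_elem _

theorem const_elem (c : Const) : (tyInterp (constType c)).IsElem (constSem c) := by
  cases c with
  | czero σ τ =>
    simp only [constType, constSem, ty_arrow, ty_sum]
    exact PrOf_elem (lawful_ty _) cts_inj0.1 fun d hd => inj0_elem hd
  | cone σ τ =>
    simp only [constType, constSem, ty_arrow, ty_sum]
    exact PrOf_elem (lawful_ty _) cts_inj1.1 fun d hd => inj1_elem hd
  | ccase σ τ ρ =>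
    have l1 := lawful_ty σ
    have l2 := lawful_ty τ
    have l3 := lawful_ty ρ
    simp only [constType, constSem, ty_arrow, ty_sum]
    refine PrOf_elem (lawful_sum l1 l2)
      (cts_PrOf fun f => cts_PrOf fun g => cts_case1 f g).1 fun d hd => ?_
    refine PrOf_elem (lawful_func l1 l3) (cts_PrOf fun g => cts_case2 d g).1 fun f hf => ?_
    exact PrOf_elem (lawful_func l2 l3) (cts_case3 d f).1 fun g hg => case_elem l1 l2 l3 hd hf hg
  | cpcase σ τ ρ =>
    have l1 := lawful_ty σ
    have l2 := lawful_ty τ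
    have l3 := lawful_ty ρ
    simp only [constType, constSem, ty_arrow, ty_sum]
    refine PrOf_elem (lawful_sum l1 l2)
      (cts_PrOf fun f => cts_PrOf fun g => cts_pcase1 f g).1 fun d hd => ?_
    refine PrOf_elem l3 (cts_PrOf fun g => cts_pcase2 d g).1 fun f hf => ?_
    exact PrOf_elem l3 (cts_pcase3 d f).1 fun g hg => pcase_elem hd hf hg
  | cpair σ τ =>
    simp only [constType, constSem, ty_arrow, ty_prod]
    refine PrOf_elem (lawful_ty _) (cts_PrOf fun e => cts_pair1 e).1 fun d hd => ?_
    exact PrOf_elem (lawful_ty _) (cts_pair2 d).1 fun e he => pair_elem hd he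
  | cfst σ τ =>
    simp only [constType, constSem, ty_arrow, ty_prod]
    exact PrOf_elem (lawful_prod (lawful_ty _) (lawful_ty _)) cts_fst.1 fun d hd => fst_elem hd
  | csnd σ τ =>
    simp only [constType, constSem, ty_arrow, ty_prod]
    exact PrOf_elem (lawful_prod (lawful_ty _) (lawful_ty _)) cts_snd.1 fun d hd => snd_elem hd
  | comega σ => exact empty_elem _

theorem good_cons {Γ : List TyExpr} {ε : Env} (hε : GoodEnv Γ ε) {σ : TyExpr} {d : Set Pm}
    (hd : (tyInterp σ).IsElem d) : GoodEnv (σ :: Γ) (envCons d ε) := by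
  rintro (_ | n) τ h
  · simp at h
    subst h
    exact hd
  · exact hε n τ (by simpa using h)

theorem sem_elem {Γ : List TyExpr} {M : Tm} {τ : TyExpr} (h : HasType Γ M τ) :
    ∀ ε, GoodEnv Γ ε → (tyInterp τ).IsElem (sem M ε) := by
  induction h with
  | var h => exact fun ε hε => hε _ _ h
  | const c => exact fun ε hε => const_elem c
  | app _ _ i1 i2 =>
    intro ε hε
    have := i1 ε hε
    rw [ty_arrow] at this
    exact aps_elem (lawful_ty _) (lawful_ty _) this (i2 ε hε)
  | @lam Γ M σ τ _ ih =>
    intro ε hε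
    rw [ty_arrow]
    exact PrOf_elem (lawful_ty _) (sem_cts M ε).1 fun d hd => ih _ (good_cons hε hd)
  | equiv _ e ih =>
    intro ε hε
    rw [← e.interp]
    exact ih ε hε

theorem app_zero {σ τ : TyExpr} {d : Set Pm} (hd : (tyInterp σ).IsElem d) :
    aps (constSem (.czero σ τ)) d = inj0 d :=
  aps_PrOf (lawful_ty _) cts_inj0 hd

theorem app_one {σ τ : TyExpr} {d : Set Pm} (hd : (tyInterp τ).IsElem d) :
    aps (constSem (.cone σ τ)) d = inj1 d :=
  aps_PrOf (lawful_ty _) cts_inj1 hd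

theorem app_fst {σ τ : TyExpr} {d : Set Pm} (hd : (tyInterp (.prod σ τ)).IsElem d) :
    aps (constSem (.cfst σ τ)) d = fstS d :=
  aps_PrOf (lawful_ty _) cts_fst hd

theorem app_snd {σ τ : TyExpr} {d : Set Pm} (hd : (tyInterp (.prod σ τ)).IsElem d) :
    aps (constSem (.csnd σ τ)) d = sndS d :=
  aps_PrOf (lawful_ty _) cts_snd hd

theorem app_pair {σ τ : TyExpr} {d e : Set Pm} (hd : (tyInterp σ).IsElem d)
    (he : (tyInterp τ).IsElem e) :
    aps (aps (constSem (.cpair σ τ)) d) e = pairS d e := by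
  simp only [constSem]
  rw [aps_PrOf (lawful_ty _) (cts_PrOf fun e => cts_pair1 e) hd,
    aps_PrOf (lawful_ty _) (cts_pair2 d) he]

theorem app_case {σ τ ρ : TyExpr} {d f g : Set Pm} (hd : (tyInterp (.sum σ τ)).IsElem d)
    (hf : (tyInterp (.arrow σ ρ)).IsElem f) (hg : (tyInterp (.arrow τ ρ)).IsElem g) :
    aps (aps (aps (constSem (.ccase σ τ ρ)) d) f) g = caseS d f g := by
  simp only [constSem]
  rw [aps_PrOf (lawful_ty _) (cts_PrOf fun f => cts_PrOf fun g => cts_case1 f g) hd,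
    aps_PrOf (lawful_ty _) (cts_PrOf fun g => cts_case2 d g) hf,
    aps_PrOf (lawful_ty _) (cts_case3 d f) hg]

theorem app_pcase {σ τ ρ : TyExpr} {d f g : Set Pm} (hd : (tyInterp (.sum σ τ)).IsElem d)
    (hf : (tyInterp ρ).IsElem f) (hg : (tyInterp ρ).IsElem g) :
    aps (aps (aps (constSem (.cpcase σ τ ρ)) d) f) g = pcaseS d f g := by
  simp only [constSem]
  rw [aps_PrOf (lawful_ty _) (cts_PrOf fun f => cts_PrOf fun g => cts_pcase1 f g) hd,
    aps_PrOf (lawful_ty _) (cts_PrOf fun g => cts_pcase2 d g) hf,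
    aps_PrOf (lawful_ty _) (cts_pcase3 d f) hg]

theorem pcase_inj0 (x y z : Set Pm) : pcaseS x (inj0 y) (inj0 z) = inj0 (pcaseS x y z) := by
  ext p
  by_cases h0 : Pm.stag false ∈ x <;> by_cases h1 : Pm.stag true ∈ x <;>
    cases p <;> simp [pcaseS, inj0, h0, h1] <;> tauto

theorem pcase_inj1 (x y z : Set Pm) : pcaseS x (inj1 y) (inj1 z) = inj1 (pcaseS x y z) := by
  ext p
  by_cases h0 : Pm.stag false ∈ x <;> by_cases h1 : Pm.stag true ∈ x <;>
    cases p <;> simp [pcaseS, inj1, h0, h1] <;> tauto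

theorem pcase_pair (x y₁ y₂ z₁ z₂ : Set Pm) : pcaseS x (pairS y₁ y₂) (pairS z₁ z₂) =
    pairS (pcaseS x y₁ z₁) (pcaseS x y₂ z₂) := by
  ext p
  by_cases h0 : Pm.stag false ∈ x <;> by_cases h1 : Pm.stag true ∈ x <;>
    rcases p with _ | _ | ⟨_ | _, _⟩ | _ <;> simp [pcaseS, pairS, h0, h1]

theorem aps_pcase {A B : PData} (hA : Lawful A) (hB : Lawful B) {x y z w : Set Pm}
    (hy : (funcP A B).IsElem y)
    (hz : (funcP A B).IsElem z) (hw : A.IsElem w) :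
    aps (pcaseS x y z) w = pcaseS x (aps y w) (aps z w) := by
  ext b
  constructor
  · rintro ⟨X, hX, (⟨h1, h2, h3, h4⟩ | ⟨h1, h2⟩ | ⟨h1, h2⟩)⟩
    · exact Or.inl ⟨h1, h2, ⟨X, hX, h3⟩, ⟨X, hX, h4⟩⟩
    · exact Or.inr (Or.inl ⟨h1, X, hX, h2⟩)
    · exact Or.inr (Or.inr ⟨h1, X, hX, h2⟩)
  · rintro (⟨h1, h2, ⟨X, hX, h3⟩, ⟨Y, hY, h4⟩⟩ | ⟨h1, X, hX, h2⟩ | ⟨h1, X, hX, h2⟩)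
    · obtain ⟨Z, hZ, hZw, hc⟩ := goodify hA hw (X ++ Y) (by
        intro x hx
        rcases List.mem_append.1 hx with hx | hx
        · exact hX x hx
        · exact hY x hx)
      obtain ⟨_, _, e, gX, hb⟩ := hy.1 h3
      cases e
      obtain ⟨_, _, e, gY, -⟩ := hz.1 h4
      cases e
      refine ⟨Z, hZw, Or.inl ⟨h1, h2, hy.2.1 _ _ ?_ h3, hz.2.1 _ _ ?_ h4⟩⟩
      · exact ⟨Z, b, X, b, rfl, rfl, hZ, hb, gX, hb, fun v hv => hc v (by simp [hv]),
          hB.le_refl _ hb⟩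
      · exact ⟨Z, b, Y, b, rfl, rfl, hZ, hb, gY, hb, fun v hv => hc v (by simp [hv]),
          hB.le_refl _ hb⟩
    · exact ⟨X, hX, Or.inr (Or.inl ⟨h1, h2⟩)⟩
    · exact ⟨X, hX, Or.inr (Or.inr ⟨h1, h2⟩)⟩

/-! ### One-step soundness and subject reduction -/

theorem ht_app1 {Γ : List TyExpr} (c : Const) {x : Tm} {a r : TyExpr}
    (hc : constType c = .arrow a r) (hx : HasType Γ x a) : HasType Γ (.app (.const c) x) r :=
  .app (hc ▸ .const c) hx

theorem step_sound {M N : Tm} (h : Step M N) : ∀ (Γ : List TyExpr) (T : TyExpr),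
    HasType Γ M T → HasType Γ N T ∧ ∀ ε, GoodEnv Γ ε → sem M ε = sem N ε := by
  induction h with
  | beta σ M N =>
    intro Γ T h
    obtain ⟨s, h1, h2⟩ := inv_app h
    obtain ⟨ρ, h3, e⟩ := inv_lam h1
    have hN : HasType Γ N σ := h2.equiv e.arrow_inv.1.symm
    refine ⟨(ht_subst0 h3 hN).equiv e.arrow_inv.2, fun ε hε => ?_⟩
    rw [sem_subst0]
    exact aps_PrOf (lawful_ty _) (sem_cts M ε) (sem_elem hN ε hε)
  | caseZero σ τ ρ σ' τ' x y z =>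
    intro Γ T h
    obtain ⟨hd, hy, hz, e⟩ := inv_c3 rfl h
    obtain ⟨hx, e'⟩ := inv_c1 rfl hd
    refine ⟨(HasType.app hy (hx.equiv e'.sum_inv.1)).equiv e, fun ε hε => ?_⟩
    have e1 : sem (.app (.const (.czero σ' τ')) x) ε = inj0 (sem x ε) :=
      app_zero (sem_elem hx ε hε)
    refine (app_case (sem_elem hd ε hε) (sem_elem hy ε hε) (sem_elem hz ε hε)).trans ?_
    rw [e1]
    ext p
    simp [caseS, inj0, prj0, sem]
  | caseOne σ τ ρ σ' τ' x y z =>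
    intro Γ T h
    obtain ⟨hd, hy, hz, e⟩ := inv_c3 rfl h
    obtain ⟨hx, e'⟩ := inv_c1 rfl hd
    refine ⟨(HasType.app hz (hx.equiv e'.sum_inv.2)).equiv e, fun ε hε => ?_⟩
    have e1 : sem (.app (.const (.cone σ' τ')) x) ε = inj1 (sem x ε) :=
      app_one (sem_elem hx ε hε)
    refine (app_case (sem_elem hd ε hε) (sem_elem hy ε hε) (sem_elem hz ε hε)).trans ?_
    rw [e1]
    ext p
    simp [caseS, inj1, prj1, sem]
  | fstPair σ τ σ' τ' x y =>
    intro Γ T h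
    obtain ⟨hd, e⟩ := inv_c1 rfl h
    obtain ⟨hx, hy, e'⟩ := inv_c2 rfl hd
    refine ⟨hx.equiv (e'.prod_inv.1.trans e), fun ε hε => ?_⟩
    have e1 : sem (.app (.app (.const (.cpair σ' τ')) x) y) ε = pairS (sem x ε) (sem y ε) :=
      app_pair (sem_elem hx ε hε) (sem_elem hy ε hε)
    refine (app_fst (sem_elem hd ε hε)).trans ?_
    rw [e1]
    ext p
    simp [pairS, fstS]
  | sndPair σ τ σ' τ' x y =>
    intro Γ T h
    obtain ⟨hd, e⟩ := inv_c1 rfl h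
    obtain ⟨hx, hy, e'⟩ := inv_c2 rfl hd
    refine ⟨hy.equiv (e'.prod_inv.2.trans e), fun ε hε => ?_⟩
    have e1 : sem (.app (.app (.const (.cpair σ' τ')) x) y) ε = pairS (sem x ε) (sem y ε) :=
      app_pair (sem_elem hx ε hε) (sem_elem hy ε hε)
    refine (app_snd (sem_elem hd ε hε)).trans ?_
    rw [e1]
    ext p
    simp [pairS, sndS]
  | pcaseZero σ τ ρ σ' τ' x y z =>
    intro Γ T h
    obtain ⟨hd, hy, hz, e⟩ := inv_c3 rfl h
    obtain ⟨hx, e'⟩ := inv_c1 rfl hd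
    refine ⟨hy.equiv e, fun ε hε => ?_⟩
    have e1 : sem (.app (.const (.czero σ' τ')) x) ε = inj0 (sem x ε) :=
      app_zero (sem_elem hx ε hε)
    refine (app_pcase (sem_elem hd ε hε) (sem_elem hy ε hε) (sem_elem hz ε hε)).trans ?_
    rw [e1]
    ext p
    simp [pcaseS, inj0]
  | pcaseOne σ τ ρ σ' τ' x y z =>
    intro Γ T h
    obtain ⟨hd, hy, hz, e⟩ := inv_c3 rfl h
    obtain ⟨hx, e'⟩ := inv_c1 rfl hd
    refine ⟨hz.equiv e, fun ε hε => ?_⟩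
    have e1 : sem (.app (.const (.cone σ' τ')) x) ε = inj1 (sem x ε) :=
      app_one (sem_elem hx ε hε)
    refine (app_pcase (sem_elem hd ε hε) (sem_elem hy ε hε) (sem_elem hz ε hε)).trans ?_
    rw [e1]
    ext p
    simp [pcaseS, inj1]
  | pcaseZZ σ τ ρ₀ ρ₁ σ₁ τ₁ σ₂ τ₂ x y z =>
    intro Γ T h
    obtain ⟨hx, hy', hz', e⟩ := inv_c3 rfl h
    obtain ⟨hy, ey⟩ := inv_c1 rfl hy'
    obtain ⟨hz, ez⟩ := inv_c1 rfl hz'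
    have hy2 := hy.equiv ey.sum_inv.1
    have hz2 := hz.equiv ez.sum_inv.1
    have hp := HasType.app (HasType.app (ht_app1 (.cpcase σ τ ρ₀) rfl hx) hy2) hz2
    refine ⟨(ht_app1 (.czero ρ₀ ρ₁) rfl hp).equiv e, fun ε hε => ?_⟩
    have e1 : sem (.app (.const (.czero σ₁ τ₁)) y) ε = inj0 (sem y ε) :=
      app_zero (sem_elem hy ε hε)
    have e2 : sem (.app (.const (.czero σ₂ τ₂)) z) ε = inj0 (sem z ε) :=
      app_zero (sem_elem hz ε hε)
    have e3 : sem (.app (.app (.app (.const (.cpcase σ τ ρ₀)) x) y) z) ε =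
        pcaseS (sem x ε) (sem y ε) (sem z ε) :=
      app_pcase (sem_elem hx ε hε) (sem_elem hy2 ε hε) (sem_elem hz2 ε hε)
    refine (app_pcase (sem_elem hx ε hε) (sem_elem hy' ε hε) (sem_elem hz' ε hε)).trans ?_
    refine Eq.trans ?_ (app_zero (sem_elem hp ε hε)).symm
    rw [e1, e2, e3, pcase_inj0]
  | pcaseOO σ τ ρ₀ ρ₁ σ₁ τ₁ σ₂ τ₂ x y z =>
    intro Γ T h
    obtain ⟨hx, hy', hz', e⟩ := inv_c3 rfl h
    obtain ⟨hy, ey⟩ := inv_c1 rfl hy'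
    obtain ⟨hz, ez⟩ := inv_c1 rfl hz'
    have hy2 := hy.equiv ey.sum_inv.2
    have hz2 := hz.equiv ez.sum_inv.2
    have hp := HasType.app (HasType.app (ht_app1 (.cpcase σ τ ρ₁) rfl hx) hy2) hz2
    refine ⟨(ht_app1 (.cone ρ₀ ρ₁) rfl hp).equiv e, fun ε hε => ?_⟩
    have e1 : sem (.app (.const (.cone σ₁ τ₁)) y) ε = inj1 (sem y ε) :=
      app_one (sem_elem hy ε hε)
    have e2 : sem (.app (.const (.cone σ₂ τ₂)) z) ε = inj1 (sem z ε) :=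
      app_one (sem_elem hz ε hε)
    have e3 : sem (.app (.app (.app (.const (.cpcase σ τ ρ₁)) x) y) z) ε =
        pcaseS (sem x ε) (sem y ε) (sem z ε) :=
      app_pcase (sem_elem hx ε hε) (sem_elem hy2 ε hε) (sem_elem hz2 ε hε)
    refine (app_pcase (sem_elem hx ε hε) (sem_elem hy' ε hε) (sem_elem hz' ε hε)).trans ?_
    refine Eq.trans ?_ (app_one (sem_elem hp ε hε)).symm
    rw [e1, e2, e3, pcase_inj1]
  | pcasePair σ τ ρ₁ ρ₂ σ₁ τ₁ σ₂ τ₂ x y₁ y₂ z₁ z₂ =>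
    intro Γ T h
    obtain ⟨hx, hy', hz', e⟩ := inv_c3 rfl h
    obtain ⟨hy1, hy2, ey⟩ := inv_c2 rfl hy'
    obtain ⟨hz1, hz2, ez⟩ := inv_c2 rfl hz'
    have ky1 := hy1.equiv ey.prod_inv.1
    have ky2 := hy2.equiv ey.prod_inv.2
    have kz1 := hz1.equiv ez.prod_inv.1
    have kz2 := hz2.equiv ez.prod_inv.2
    have hp1 := HasType.app (HasType.app (ht_app1 (.cpcase σ τ ρ₁) rfl hx) ky1) kz1
    have hp2 := HasType.app (HasType.app (ht_app1 (.cpcase σ τ ρ₂) rfl hx) ky2) kz2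
    refine ⟨(HasType.app (ht_app1 (.cpair ρ₁ ρ₂) rfl hp1) hp2).equiv e, fun ε hε => ?_⟩
    have e1 : sem (.app (.app (.const (.cpair σ₁ τ₁)) y₁) y₂) ε = pairS (sem y₁ ε) (sem y₂ ε) :=
      app_pair (sem_elem hy1 ε hε) (sem_elem hy2 ε hε)
    have e2 : sem (.app (.app (.const (.cpair σ₂ τ₂)) z₁) z₂) ε = pairS (sem z₁ ε) (sem z₂ ε) :=
      app_pair (sem_elem hz1 ε hε) (sem_elem hz2 ε hε)
    have e3 : sem (.app (.app (.app (.const (.cpcase σ τ ρ₁)) x) y₁) z₁) ε =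
        pcaseS (sem x ε) (sem y₁ ε) (sem z₁ ε) :=
      app_pcase (sem_elem hx ε hε) (sem_elem ky1 ε hε) (sem_elem kz1 ε hε)
    have e4 : sem (.app (.app (.app (.const (.cpcase σ τ ρ₂)) x) y₂) z₂) ε =
        pcaseS (sem x ε) (sem y₂ ε) (sem z₂ ε) :=
      app_pcase (sem_elem hx ε hε) (sem_elem ky2 ε hε) (sem_elem kz2 ε hε)
    refine (app_pcase (sem_elem hx ε hε) (sem_elem hy' ε hε) (sem_elem hz' ε hε)).trans ?_
    refine Eq.trans ?_ (app_pair (sem_elem hp1 ε hε) (sem_elem hp2 ε hε)).symm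
    rw [e1, e2, e3, e4, pcase_pair]
  | pcaseArrow σ τ ρ₁ ρ₂ x y z w =>
    intro Γ T h
    obtain ⟨s, h1, hw'⟩ := inv_app h
    obtain ⟨hx, hy, hz, e⟩ := inv_c3 rfl h1
    have hw := hw'.equiv e.arrow_inv.1.symm
    have hyw := HasType.app hy hw
    have hzw := HasType.app hz hw
    refine ⟨(HasType.app (HasType.app (ht_app1 (.cpcase σ τ ρ₂) rfl hx) hyw) hzw).equiv
      e.arrow_inv.2, fun ε hε => ?_⟩
    have e1 : sem (.app (.app (.app (.const (.cpcase σ τ (.arrow ρ₁ ρ₂))) x) y) z) ε =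
        pcaseS (sem x ε) (sem y ε) (sem z ε) :=
      app_pcase (sem_elem hx ε hε) (sem_elem hy ε hε) (sem_elem hz ε hε)
    refine Eq.trans ?_
      (app_pcase (sem_elem hx ε hε) (sem_elem hyw ε hε) (sem_elem hzw ε hε)).symm
    have ky := sem_elem hy ε hε
    have kz := sem_elem hz ε hε
    rw [ty_arrow] at ky kz
    rw [sem, e1]
    exact aps_pcase (lawful_ty _) (lawful_ty _) ky kz (sem_elem hw ε hε)
  | appL N _ ih =>
    intro Γ T h
    obtain ⟨s, h1, h2⟩ := inv_app h
    obtain ⟨h3, h4⟩ := ih _ _ h1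
    refine ⟨.app h3 h2, fun ε hε => ?_⟩
    simp only [sem, h4 ε hε]
  | appR M _ ih =>
    intro Γ T h
    obtain ⟨s, h1, h2⟩ := inv_app h
    obtain ⟨h3, h4⟩ := ih _ _ h2
    refine ⟨.app h1 h3, fun ε hε => ?_⟩
    simp only [sem, h4 ε hε]
  | lamC σ _ ih =>
    intro Γ T h
    obtain ⟨ρ, h1, e⟩ := inv_lam h
    obtain ⟨h3, h4⟩ := ih _ _ h1
    refine ⟨(HasType.lam h3).equiv e, fun ε hε => ?_⟩
    exact PrOf_congr (lawful_ty _) fun d hd => h4 _ (good_cons hε hd)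

/-- **Soundness.**  If `M` and `N` are typed terms and `M →* N`,
then `⟦M⟧ε = ⟦N⟧ε` for every (typed) environment `ε`.  In particular the
Substitution Lemma holds: `⟦M[x := N]⟧ε = ⟦M⟧(ε[x ↦ ⟦N⟧ε])` (here stated for the
de Bruijn variable `0`). -/
theorem soundness_and_substitution :
    (∀ (Γ : List TyExpr) (M N : Tm) (σ : TyExpr), HasType Γ M σ → Steps M N →
      ∀ ε : Env, GoodEnv Γ ε → sem M ε = sem N ε) ∧
    (∀ (Γ : List TyExpr) (M N : Tm) (σ τ : TyExpr),
      HasType (σ :: Γ) M τ → HasType Γ N σ →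
      ∀ ε : Env, GoodEnv Γ ε →
        sem (substTm M 0 N) ε = sem M (envCons (sem N ε) ε)) := by
  refine ⟨?_, fun Γ M N σ τ _ _ ε _ => sem_subst0 M N ε⟩
  intro Γ M N σ hM hs ε hε
  have key : HasType Γ N σ ∧ sem M ε = sem N ε := by
    induction hs with
    | refl => exact ⟨hM, rfl⟩
    | tail _ h ih =>
      obtain ⟨h1, h2⟩ := step_sound h _ _ ih.1
      exact ⟨h1, ih.2.trans (h2 ε hε)⟩
  exact key.2

end RecLam
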